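/- arXiv:1912.13008 — 4 statements merged into one kernel-verified Lean document; each statement's English description precedes it below -/
import Mathlib

section
/- For any two nonempty compact subsets X, Y of ℝ, d_{H,iso}(X,Y) ≤ (5/4)·d_GH(X,Y). -/
/-- Gromov-Hausdorff distance between nonempty compact subsets of a metric space. -/
noncomputable def ghDistSet {E : Type*} [MetricSpace E] (X Y : Set E)
    (hX : IsCompact X) (hXn : X.Nonempty) (hY : IsCompact Y) (hYn : Y.Nonempty) : ℝ :=
  haveI := hXn.to_subtype
  haveI := hYn.to_subtype
  haveI := isCompact_iff_compactSpace.mp hX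
  haveI := isCompact_iff_compactSpace.mp hY
  GromovHausdorff.ghDist X Y

/-- `d_{H,iso}`: infimum over isometries `t ↦ ±t + c` of `ℝ` of the Hausdorff distance. -/
noncomputable def dHiso (X Y : Set ℝ) : ℝ :=
  sInf {r | ∃ ε c : ℝ, (ε = 1 ∨ ε = -1) ∧
    r = Metric.hausdorffDist X ((fun t => ε * t + c) '' Y)}

/-- The rotated picture of a correspondence between subsets of `ℝ`: `R s d` holds when
`s = x + y` and `d = y - x` for a related pair `(x, y)`. Distortion at most `D` means that any two
points are `D`-close in one of the coordinates. The bounding box `[-w, w] × [-h, h]` is centered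
and each of its sides is touched. -/
structure IsRotatedCorr (R : ℝ → ℝ → Prop) (D w h : ℝ) : Prop where
  close : ∀ {s d s' d'}, R s d → R s' d' → |s - s'| ≤ D ∨ |d - d'| ≤ D
  bound : ∀ {s d}, R s d → |s| ≤ w ∧ |d| ≤ h
  bot : ∃ p, R p (-h)
  top : ∃ p, R p h
  left : ∃ q, R (-w) q
  right : ∃ q, R w q

/-- After translating by `c`, every point of each of the two sets is within `5 / 8 * D` of the
other one, in rotated coordinates. -/
def IsMatched (R : ℝ → ℝ → Prop) (D c : ℝ) : Prop :=
  ∀ s d, R s d → (∃ s' d', R s' d' ∧ |s' - s + d + d' - 2 * c| ≤ 5 / 4 * D) ∧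
    ∃ s' d', R s' d' ∧ |s - s' + d + d' - 2 * c| ≤ 5 / 4 * D

namespace IsRotatedCorr

variable {R : ℝ → ℝ → Prop} {D w h : ℝ}

theorem negFst (H : IsRotatedCorr R D w h) : IsRotatedCorr (fun s d => R (-s) d) D w h where
  close := fun {s d s' d'} h₁ h₂ => by
    have := H.close h₁ h₂
    rwa [show -s - -s' = -(s - s') by ring, abs_neg] at this
  bound h₁ := by simpa using H.bound h₁
  bot := let ⟨p, hp⟩ := H.bot; ⟨-p, by simpa using hp⟩
  top := let ⟨p, hp⟩ := H.top; ⟨-p, by simpa using hp⟩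
  left := by simpa using H.right
  right := H.left

theorem swap (H : IsRotatedCorr R D w h) : IsRotatedCorr (fun s d => R d s) D h w where
  close h₁ h₂ := (H.close h₁ h₂).symm
  bound h₁ := (H.bound h₁).symm
  bot := H.left
  top := H.right
  left := H.bot
  right := H.top

theorem negSnd (H : IsRotatedCorr R D w h) : IsRotatedCorr (fun s d => R s (-d)) D w h :=
  H.swap.negFst.swap

/-- If both sides of the box exceed `2 * D`, the extremal points form a pinwheel, which turns in one
of two directions. -/
theorem pinwheel (H : IsRotatedCorr R D w h) (hh : D < h) (hw : D < w) {p₀ p₁ q₀ q₁ : ℝ}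
    (hp₀ : R p₀ (-h)) (hp₁ : R p₁ h) (hq₀ : R (-w) q₀) (hq₁ : R w q₁) :
    (p₀ ≤ D - w ∧ w - D ≤ p₁ ∧ h - D ≤ q₀ ∧ q₁ ≤ D - h) ∨
      (w - D ≤ p₀ ∧ p₁ ≤ D - w ∧ q₀ ≤ D - h ∧ h - D ≤ q₁) := by
  have h₁ := H.close hp₀ hq₀
  have h₂ := H.close hp₁ hq₀
  have h₃ := H.close hq₁ hp₀
  have h₄ := H.close hq₁ hp₁
  simp only [abs_le] at h₁ h₂ h₃ h₄
  grind

theorem close_fst (H : IsRotatedCorr R D w h) {s d s' d' : ℝ} (h₁ : R s d) (h₂ : R s' d')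
    (hd : D < d - d') : -D ≤ s - s' ∧ s - s' ≤ D :=
  abs_le.1 ((H.close h₁ h₂).resolve_right fun h' => by linarith [le_abs_self (d - d')])

/-- Upper points are matched by the extremal bottom or top point when the pinwheel turns
counterclockwise. -/
theorem exists_match_of_right (H : IsRotatedCorr R D w h) (hD : 0 ≤ D) (hh : D < h) (hhw : h ≤ w)
    {p₀ p₁ g s d : ℝ} (hp₀ : R p₀ (-h)) (hp₁ : R p₁ h) (h₀ : w - D ≤ p₀) (h₁ : p₁ ≤ D - w)
    (hg' : g ≤ D / 8) (hsd : R s d) (hd : 5 / 8 * D - g < d) :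
    ∃ s' d', R s' d' ∧ |s' - s + d + d' - 2 * (-g)| ≤ 5 / 4 * D := by
  have hb := H.bound hsd
  simp only [abs_le] at hb
  have c₁ := H.close_fst hsd hp₀ (by linarith)
  have c₂ := H.close_fst hp₁ hp₀ (by linarith)
  by_cases hs : -(5 / 4 * D) ≤ p₀ - s + d + -h - 2 * (-g)
  · exact ⟨_, _, hp₀, abs_le.2 ⟨hs, by linarith⟩⟩
  · exact ⟨_, _, hp₁, abs_le.2 ⟨by linarith, by linarith⟩⟩

/-- Upper points are matched, after a shift, by the extremal bottom or left point when the pinwheel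
turns clockwise. -/
theorem exists_match_of_left (H : IsRotatedCorr R D w h) (hD : 0 ≤ D) (hh : D < h) (hhw : h ≤ w)
    {p₀ p₁ q₀ q₁ g s d : ℝ} (hp₀ : R p₀ (-h)) (hp₁ : R p₁ h) (hq₀ : R (-w) q₀) (hq₁ : R w q₁)
    (h₀ : p₀ ≤ D - w) (h₁ : w - D ≤ p₁) (h₂ : h - D ≤ q₀) (h₃ : q₁ ≤ D - h)
    (hg' : g ≤ D / 8) (hsd : R s d) (hd : 5 / 8 * D - g < d)
    (hdg : 7 / 4 * D ≤ d + h + 2 * g) :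
    ∃ s' d', R s' d' ∧ |s' - s + d + d' - 2 * (-g)| ≤ 5 / 4 * D := by
  have hb := H.bound hsd
  simp only [abs_le] at hb
  have c₁ := H.close_fst hsd hp₀ (by linarith)
  have c₂ := H.close_fst hp₁ hp₀ (by linarith)
  have c₃ := H.swap.close_fst hq₁ hq₀ (by linarith)
  by_cases hs : -(5 / 4 * D) ≤ p₀ - s + d + -h - 2 * (-g)
  · exact ⟨_, _, hp₀, abs_le.2 ⟨hs, by linarith⟩⟩
  · exact ⟨_, _, hq₀, abs_le.2 ⟨by linarith, by linarith⟩⟩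

/-- An unmatched upper point forces enough structure for a shift by `D / 8` to work, once the points
above `D / 2` are known to be matched after that shift. -/
theorem isMatched_shift (H : IsRotatedCorr R D w h) (hh : h ≤ 9 / 8 * D) {s d : ℝ}
    (hsd : R s d) (hd : 5 / 8 * D < d) (hd' : d < 3 / 4 * D)
    (hun : ∀ s' d', R s' d' → 5 / 4 * D < |s' - s + d + d'|)
    (hup : ∀ s₂ d₂, R s₂ d₂ → D / 2 < d₂ →
      (∃ s' d', R s' d' ∧ |s' - s₂ + d₂ + d' - 2 * (-(D / 8))| ≤ 5 / 4 * D) ∧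
        ∃ s' d', R s' d' ∧ |s₂ - s' + d₂ + d' - 2 * (-(D / 8))| ≤ 5 / 4 * D) :
    IsMatched R D (-(D / 8)) := by
  intro s₂ d₂ h₂
  have hb := H.bound h₂
  simp only [abs_le] at hb
  rcases lt_or_ge (D / 2) d₂ with h₃ | h₃
  · exact hup _ _ h₂ h₃
  rcases le_or_gt (-(3 / 4 * D)) d₂ with h₄ | h₄
  · constructor <;> exact ⟨s₂, d₂, h₂, abs_le.2 ⟨by linarith, by linarith⟩⟩
  have c := H.close_fst hsd h₂ (by linarith)
  have h₅ : d + d₂ < -(D / 4) := by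
    by_contra! h₅
    exact (hun _ _ h₂).not_ge (abs_le.2 ⟨by linarith, by linarith⟩)
  constructor <;> exact ⟨s, d, hsd, abs_le.2 ⟨by linarith, by linarith⟩⟩

theorem isMatched_of_unmatched (H : IsRotatedCorr R D w h) (hD : 0 ≤ D)
    (hhw : h ≤ D ∨ (D < h ∧ h ≤ w)) {s d : ℝ} (hsd : R s d) (hd : 5 / 8 * D < d)
    (hun : ∀ s' d', R s' d' → 5 / 4 * D < |s' - s + d + d'|) :
    IsMatched R D (-(D / 8)) := by
  obtain ⟨p₀, hp₀⟩ := H.bot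
  have hb := H.bound hsd
  simp only [abs_le] at hb
  have c := H.close_fst hsd hp₀ (by linarith)
  have hdh : d < h - D / 4 := by
    by_contra! h'
    exact (hun _ _ hp₀).not_ge (abs_le.2 ⟨by linarith, by linarith⟩)
  rcases hhw with hh | ⟨hh, hhw⟩
  · refine H.isMatched_shift (by linarith) hsd hd (by linarith) hun fun s₂ d₂ h₂ h₃ => ?_
    have hb₂ := H.bound h₂
    simp only [abs_le] at hb₂
    have c₂ := H.close_fst h₂ hp₀ (by linarith)
    constructor <;> exact ⟨p₀, -h, hp₀, abs_le.2 ⟨by linarith, by linarith⟩⟩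
  obtain ⟨p₁, hp₁⟩ := H.top
  obtain ⟨q₀, hq₀⟩ := H.left
  obtain ⟨q₁, hq₁⟩ := H.right
  rcases H.pinwheel hh (by linarith) hp₀ hp₁ hq₀ hq₁ with ⟨h₀, h₁, h₂, h₃⟩ | ⟨h₀, h₁, -, -⟩
  · have hdh' : d + h < 7 / 4 * D := by
      by_contra! h'
      obtain ⟨s', d', h₄, h₅⟩ := H.exists_match_of_left hD hh hhw hp₀ hp₁ hq₀ hq₁ h₀ h₁ h₂ h₃
        (g := 0) (by linarith) hsd (by linarith) (by linarith)
      exact (hun _ _ h₄).not_ge (by simpa using h₅)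
    refine H.isMatched_shift (by linarith) hsd hd (by linarith) hun fun s₂ d₂ h₄ h₅ => ⟨?_, ?_⟩
    · exact H.exists_match_of_left hD hh hhw hp₀ hp₁ hq₀ hq₁ h₀ h₁ h₂ h₃
        le_rfl h₄ (by linarith) (by linarith)
    · obtain ⟨s', d', h₆, h₇⟩ := H.negFst.exists_match_of_right (p₀ := -p₀) (p₁ := -p₁)
        (s := -s₂) (g := D / 8) hD hh hhw (by simpa using hp₀) (by simpa using hp₁)
        (by linarith) (by linarith) le_rfl (by simpa using h₄) (by linarith)
      exact ⟨-s', d', h₆, by rwa [show s₂ - -s' = s' - -s₂ by ring]⟩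
  · obtain ⟨s', d', h₄, h₅⟩ := H.exists_match_of_right hD hh hhw hp₀ hp₁ h₀ h₁
      (g := 0) (by linarith) hsd (by linarith)
    exact absurd (by simpa using h₅) (hun _ _ h₄).not_ge

end IsRotatedCorr

theorem IsMatched.of_negFst {R : ℝ → ℝ → Prop} {D c : ℝ}
    (H : IsMatched (fun s d => R (-s) d) D c) : IsMatched R D c := by
  intro s d hsd
  obtain ⟨⟨s₁, d₁, h₁, k₁⟩, s₂, d₂, h₂, k₂⟩ := H (-s) d (by simpa using hsd)
  exact ⟨⟨-s₂, d₂, h₂, by rwa [show -s₂ - s = -s - s₂ by ring]⟩,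
    -s₁, d₁, h₁, by rwa [show s - -s₁ = s₁ - -s by ring]⟩

theorem IsMatched.of_negSnd {R : ℝ → ℝ → Prop} {D c : ℝ}
    (H : IsMatched (fun s d => R s (-d)) D c) : IsMatched R D (-c) := by
  intro s d hsd
  obtain ⟨⟨s₁, d₁, h₁, k₁⟩, s₂, d₂, h₂, k₂⟩ := H s (-d) (by simpa using hsd)
  refine ⟨⟨s₂, -d₂, h₂, ?_⟩, s₁, -d₁, h₁, ?_⟩
  · rwa [← abs_neg, show -(s₂ - s + d + -d₂ - 2 * -c) = s - s₂ + -d + d₂ - 2 * c by ring]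
  · rwa [← abs_neg, show -(s - s₁ + d + -d₁ - 2 * -c) = s₁ - s + -d + d₁ - 2 * c by ring]

namespace IsRotatedCorr

variable {R : ℝ → ℝ → Prop} {D w h : ℝ}

/-- Either the upper points are matched without a shift, or some shift matches everything. -/
theorem matched_upper_or (H : IsRotatedCorr R D w h) (hD : 0 ≤ D)
    (hhw : h ≤ D ∨ (D < h ∧ h ≤ w)) :
    (∀ s d, R s d → 5 / 8 * D < d → (∃ s' d', R s' d' ∧ |s' - s + d + d'| ≤ 5 / 4 * D) ∧
      ∃ s' d', R s' d' ∧ |s - s' + d + d'| ≤ 5 / 4 * D) ∨ ∃ c, IsMatched R D c := by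
  by_contra! hcon
  obtain ⟨⟨s, d, hsd, hd, himp⟩, hno⟩ := hcon
  by_cases hun : ∀ s' d', R s' d' → 5 / 4 * D < |s' - s + d + d'|
  · exact hno _ (H.isMatched_of_unmatched hD hhw hsd hd hun)
  · push Not at hun
    have hun' := himp hun
    refine hno _ (H.negFst.isMatched_of_unmatched (s := -s) hD hhw (by simpa using hsd) hd
      fun s' d' h' => ?_).of_negFst
    have := hun' _ _ h'
    rwa [show s - -s' = s' - -s by ring] at this

theorem exists_isMatched_of_le (H : IsRotatedCorr R D w h) (hD : 0 ≤ D)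
    (hhw : h ≤ D ∨ (D < h ∧ h ≤ w)) : ∃ c, IsMatched R D c := by
  rcases H.matched_upper_or hD hhw with hup | hc
  · rcases H.negSnd.matched_upper_or hD hhw with hlo | ⟨c, hc⟩
    · refine ⟨0, fun s d hsd => ?_⟩
      rcases lt_or_ge (5 / 8 * D) d with hd | hd
      · simpa using hup s d hsd hd
      rcases lt_or_ge (5 / 8 * D) (-d) with hd' | hd'
      · obtain ⟨⟨s₁, d₁, h₁, k₁⟩, s₂, d₂, h₂, k₂⟩ := hlo s (-d) (by simpa using hsd) hd'
        refine ⟨⟨s₂, -d₂, h₂, ?_⟩, s₁, -d₁, h₁, ?_⟩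
        · rwa [← abs_neg, show -(s₂ - s + d + -d₂ - 2 * 0) = s - s₂ + -d + d₂ by ring]
        · rwa [← abs_neg, show -(s - s₁ + d + -d₁ - 2 * 0) = s₁ - s + -d + d₁ by ring]
      · constructor <;> exact ⟨s, d, hsd, abs_le.2 ⟨by linarith, by linarith⟩⟩
    · exact ⟨_, hc.of_negSnd⟩
  · exact hc

theorem exists_isMatched (H : IsRotatedCorr R D w h) (hD : 0 ≤ D) :
    (∃ c, IsMatched R D c) ∨ ∃ c, IsMatched (fun s d => R d s) D c := by
  by_cases h₁ : h ≤ D ∨ (D < h ∧ h ≤ w)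
  · exact .inl (H.exists_isMatched_of_le hD h₁)
  · exact .inr (H.swap.exists_isMatched_of_le hD (by grind))

end IsRotatedCorr

/-- A compact correspondence of distortion at most `D` between subsets of `ℝ` can be aligned by an
isometry of `ℝ` up to `5 / 8 * D`. -/
theorem exists_isometry_matching {S : Set (ℝ × ℝ)} (hS : IsCompact S) (hne : S.Nonempty) {D : ℝ}
    (hdis : ∀ p ∈ S, ∀ q ∈ S, |(|p.1 - q.1| - |p.2 - q.2|)| ≤ D) :
    ∃ ε c : ℝ, (ε = 1 ∨ ε = -1) ∧ ∀ p ∈ S,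
      (∃ q ∈ S, |p.1 - (ε * q.2 + c)| ≤ 5 / 8 * D) ∧
        ∃ q ∈ S, |q.1 - (ε * p.2 + c)| ≤ 5 / 8 * D := by
  have hD : 0 ≤ D := let ⟨p, hp⟩ := hne; (abs_nonneg _).trans (hdis p hp p hp)
  have hs : ContinuousOn (fun p : ℝ × ℝ => p.1 + p.2) S := by fun_prop
  have hd : ContinuousOn (fun p : ℝ × ℝ => p.2 - p.1) S := by fun_prop
  obtain ⟨q₀, hq₀, hq₀'⟩ := hS.exists_isMinOn hne hs
  obtain ⟨q₁, hq₁, hq₁'⟩ := hS.exists_isMaxOn hne hs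
  obtain ⟨p₀, hp₀, hp₀'⟩ := hS.exists_isMinOn hne hd
  obtain ⟨p₁, hp₁, hp₁'⟩ := hS.exists_isMaxOn hne hd
  simp only [isMinOn_iff, isMaxOn_iff] at hq₀' hq₁' hp₀' hp₁'
  set m := (q₀.1 + q₀.2 + (q₁.1 + q₁.2)) / 2 with hm
  set n := (p₀.2 - p₀.1 + (p₁.2 - p₁.1)) / 2 with hn
  let R : ℝ → ℝ → Prop := fun s d => ∃ p ∈ S, p.1 + p.2 = s + m ∧ p.2 - p.1 = d + n
  have hR : ∀ p ∈ S, R (p.1 + p.2 - m) (p.2 - p.1 - n) := fun p hp => ⟨p, hp, by ring, by ring⟩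
  have H : IsRotatedCorr R D ((q₁.1 + q₁.2 - (q₀.1 + q₀.2)) / 2)
      ((p₁.2 - p₁.1 - (p₀.2 - p₀.1)) / 2) := by
    refine ⟨?_, ?_, ⟨_, p₀, hp₀, (sub_add_cancel _ m).symm, ?_⟩,
      ⟨_, p₁, hp₁, (sub_add_cancel _ m).symm, ?_⟩, ⟨_, q₀, hq₀, ?_, (sub_add_cancel _ n).symm⟩,
      ⟨_, q₁, hq₁, ?_, (sub_add_cancel _ n).symm⟩⟩
    · rintro s d s' d' ⟨p, hp, h₁, h₂⟩ ⟨q, hq, h₃, h₄⟩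
      have := hdis p hp q hq
      rw [show s - s' = (p.1 - q.1) + (p.2 - q.2) by linarith,
        show d - d' = (p.2 - q.2) - (p.1 - q.1) by linarith]
      grind
    · rintro s d ⟨p, hp, h₁, h₂⟩
      have := hq₀' p hp
      have := hq₁' p hp
      have := hp₀' p hp
      have := hp₁' p hp
      constructor <;> rw [abs_le] <;> constructor <;> linarith
    all_goals linarith
  rcases H.exists_isMatched hD with ⟨c, hc⟩ | ⟨c, hc⟩
  · refine ⟨1, -(c + n), .inl rfl, fun p hp => ?_⟩
    obtain ⟨⟨s₁, d₁, ⟨q, hq, h₁, h₂⟩, h₃⟩, s₂, d₂, ⟨q', hq', h₄, h₅⟩, h₆⟩ := hc _ _ (hR p hp)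
    simp only [abs_le] at h₃ h₆ ⊢
    exact ⟨⟨q, hq, by constructor <;> linarith⟩, q', hq', by constructor <;> linarith⟩
  · refine ⟨-1, c + m, .inr rfl, fun p hp => ?_⟩
    obtain ⟨⟨s₁, d₁, ⟨q, hq, h₁, h₂⟩, h₃⟩, s₂, d₂, ⟨q', hq', h₄, h₅⟩, h₆⟩ := hc _ _ (hR p hp)
    simp only [abs_le] at h₃ h₆ ⊢
    exact ⟨⟨q, hq, by constructor <;> linarith⟩, q', hq', by constructor <;> linarith⟩

/-- The Gromov-Hausdorff distance is realized by a compact correspondence. -/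
theorem GromovHausdorff.exists_compact_correspondence (X Y : Type*) [MetricSpace X] [CompactSpace X]
    [Nonempty X] [MetricSpace Y] [CompactSpace Y] [Nonempty Y] :
    ∃ S : Set (X × Y), IsCompact S ∧ (∀ x, ∃ y, (x, y) ∈ S) ∧ (∀ y, ∃ x, (x, y) ∈ S) ∧
      ∀ p ∈ S, ∀ q ∈ S, |dist p.1 q.1 - dist p.2 q.2| ≤ 2 * ghDist X Y := by
  have hl := isometry_optimalGHInjl X Y
  have hr := isometry_optimalGHInjr X Y
  have hcl := isCompact_range hl.continuous
  have hcr := isCompact_range hr.continuous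
  have hfin := Metric.hausdorffEDist_ne_top_of_nonempty_of_bounded (Set.range_nonempty _)
    (Set.range_nonempty _) hcl.isBounded hcr.isBounded
  have hclosed : IsClosed {p : X × Y |
      dist (optimalGHInjl X Y p.1) (optimalGHInjr X Y p.2) ≤ ghDist X Y} :=
    isClosed_le ((hl.continuous.comp continuous_fst).dist (hr.continuous.comp continuous_snd))
      continuous_const
  refine ⟨_, hclosed.isCompact, fun x => ?_, fun y => ?_, fun p hp q hq => ?_⟩
  · obtain ⟨_, ⟨y, rfl⟩, hy⟩ := hcr.exists_infDist_eq_dist (Set.range_nonempty _)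
      (optimalGHInjl X Y x)
    refine ⟨y, ?_⟩
    rw [Set.mem_ofPred_eq, ← hy, ← hausdorffDist_optimal]
    exact Metric.infDist_le_hausdorffDist_of_mem (Set.mem_range_self x) hfin
  · obtain ⟨_, ⟨x, rfl⟩, hx⟩ := hcl.exists_infDist_eq_dist (Set.range_nonempty _)
      (optimalGHInjr X Y y)
    refine ⟨x, ?_⟩
    rw [Set.mem_ofPred_eq, dist_comm, ← hx, ← hausdorffDist_optimal, Metric.hausdorffDist_comm]
    exact Metric.infDist_le_hausdorffDist_of_mem (Set.mem_range_self y)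
      (by rwa [Metric.hausdorffEDist_comm])
  · rw [← hl.dist_eq, ← hr.dist_eq]
    have := dist_dist_dist_le (optimalGHInjl X Y p.1) (optimalGHInjl X Y q.1)
      (optimalGHInjr X Y p.2) (optimalGHInjr X Y q.2)
    rw [Real.dist_eq] at this
    simp only [Set.mem_ofPred_eq] at hp hq
    linarith

theorem dHiso_le_five_fourth_ghDist (X Y : Set ℝ)
    (hX : IsCompact X) (hXn : X.Nonempty) (hY : IsCompact Y) (hYn : Y.Nonempty) :
    dHiso X Y ≤ (5 / 4) * ghDistSet X Y hX hXn hY hYn := by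
  have := hXn.to_subtype
  have := hYn.to_subtype
  have := isCompact_iff_compactSpace.mp hX
  have := isCompact_iff_compactSpace.mp hY
  change dHiso X Y ≤ 5 / 4 * GromovHausdorff.ghDist X Y
  obtain ⟨S, hS, hSX, hSY, hdis⟩ := GromovHausdorff.exists_compact_correspondence X Y
  have hne : S.Nonempty := by
    obtain ⟨x, hx⟩ := hXn
    obtain ⟨y, hy⟩ := hSX ⟨x, hx⟩
    exact ⟨_, hy⟩
  obtain ⟨ε, c, hε, hmatch⟩ := exists_isometry_matching
    (S := (fun p : X × Y => ((p.1 : ℝ), (p.2 : ℝ))) '' S) (D := 2 * GromovHausdorff.ghDist X Y)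
    (hS.image (by fun_prop)) (hne.image _) (by
      rintro _ ⟨p, hp, rfl⟩ _ ⟨q, hq, rfl⟩
      simpa [Subtype.dist_eq, Real.dist_eq] using hdis p hp q hq)
  rw [show 5 / 8 * (2 * GromovHausdorff.ghDist X Y) = 5 / 4 * GromovHausdorff.ghDist X Y by ring]
    at hmatch
  have hbdd : BddBelow {r | ∃ ε c : ℝ, (ε = 1 ∨ ε = -1) ∧
      r = Metric.hausdorffDist X ((fun t => ε * t + c) '' Y)} :=
    ⟨0, by rintro _ ⟨_, _, -, rfl⟩; exact Metric.hausdorffDist_nonneg⟩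
  refine (csInf_le hbdd ⟨ε, c, hε, rfl⟩).trans (Metric.hausdorffDist_le_of_mem_dist ?_ ?_ ?_)
  · obtain ⟨p, hp⟩ := hne
    obtain ⟨⟨q, -, hq⟩, -⟩ := hmatch _ ⟨p, hp, rfl⟩
    exact (abs_nonneg _).trans hq
  · intro x hx
    obtain ⟨y, hy⟩ := hSX ⟨x, hx⟩
    obtain ⟨⟨_, ⟨q, -, rfl⟩, hq⟩, -⟩ := hmatch _ ⟨_, hy, rfl⟩
    exact ⟨_, ⟨q.2, q.2.2, rfl⟩, hq⟩
  · rintro _ ⟨y, hy, rfl⟩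
    obtain ⟨x, hx⟩ := hSY ⟨y, hy⟩
    obtain ⟨-, _, ⟨q, -, rfl⟩, hq⟩ := hmatch _ ⟨_, hx, rfl⟩
    exact ⟨q.1, q.1.2, by rwa [dist_comm]⟩
end

section
/- Let C be a correspondence between nonempty compact X, Y ⊆ ℝ with distortion D. Then there exists an isometry T of ℝ such that the Hausdorff distance d_H(X, T(Y)) ≤ (5/8)·D. -/
/-- A correspondence between subsets `X` and `Y` of `ℝ`. -/
def IsCorrOn (X Y : Set ℝ) (C : Set (ℝ × ℝ)) : Prop :=
  C ⊆ X ×ˢ Y ∧ (∀ x ∈ X, ∃ y, (x, y) ∈ C) ∧ (∀ y ∈ Y, ∃ x, (x, y) ∈ C)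

/-- A point `p` of a family with differences `f = x - y` and sums `s = x + y` such that, after `y` is
translated by `c`, the point `x p` is at distance more than `5 / 8 * D` from all the `y q`.
Replacing `s` by `-s` exchanges the roles of `x` and `y`. -/
def Unmatched {ι : Type*} (f s : ι → ℝ) (D c : ℝ) (p : ι) : Prop :=
  ∀ q, 5 / 4 * D < |f p + f q - 2 * c + (s p - s q)|

/-- There is an interval of translations such that no point is unmatched with too large a difference
at the left end, none is unmatched with too small a difference at the right end, and the two
defects never occur together. -/
def Alignable {ι : Type*} (f s : ι → ℝ) (D : ℝ) : Prop :=
  ∃ m τ : ℝ, 0 ≤ τ ∧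
    (∀ p, m - τ + 5 / 8 * D < f p →
      ¬ (Unmatched f s D (m - τ) p ∨ Unmatched f (-s) D (m - τ) p)) ∧
    (∀ p, f p < m + τ - 5 / 8 * D →
      ¬ (Unmatched f s D (m + τ) p ∨ Unmatched f (-s) D (m + τ) p)) ∧
    ∀ c ∈ Set.Icc (m - τ) (m + τ), ∀ p q, c + 5 / 8 * D < f p → f q < c - 5 / 8 * D →
      (Unmatched f s D c p ∨ Unmatched f (-s) D c p) →
      ¬ (Unmatched f s D c q ∨ Unmatched f (-s) D c q)

section

variable {ι : Type*} {f s : ι → ℝ} {D : ℝ}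

lemma Alignable.of_neg (h : Alignable f (-s) D) : Alignable f s D := by
  obtain ⟨m, τ, h0, h1, h2, h3⟩ := h
  rw [neg_neg] at h1 h2 h3
  exact ⟨m, τ, h0, fun p hp hb => h1 p hp hb.symm, fun p hp hb => h2 p hp hb.symm,
    fun c hc p q hp hq hb hb' => h3 c hc p q hp hq hb.symm hb'.symm⟩

lemma Unmatched.neg_neg {c : ℝ} {p : ι} (h : Unmatched f s D c p) :
    Unmatched (-f) (-s) D (-c) p := by
  intro q
  have := h q
  rw [← abs_neg] at this
  convert this using 2
  simp only [Pi.neg_apply]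
  ring

lemma abs_sub_neg_le_or (h : ∀ p q, |f p - f q| ≤ D ∨ |s p - s q| ≤ D) (p q : ι) :
    |(-f) p - (-f) q| ≤ D ∨ |(-s) p - (-s) q| ≤ D := by
  simp only [Pi.neg_apply, neg_sub_neg]
  exact h q p

lemma lt_of_unmatched_of_width_le
    (h : ∀ p q, |f p - f q| ≤ D ∨ |s p - s q| ≤ D) {a b : ι} (hb : ∀ p, f p ≤ f b)
    (hw : f b - f a ≤ 2 * D) {m c : ℝ} (hm : 2 * m = f a + f b)
    (hc : m - D / 8 ≤ c) {p : ι} (hp : c + 5 / 8 * D < f p)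
    (hu : Unmatched f s D c p ∨ Unmatched f (-s) D c p) :
    f p < m + 3 / 4 * D + 2 * (c - m) := by
  have hpb := hb p
  have hs : |s p - s a| ≤ D := by
    refine (h p a).resolve_left fun hh => ?_
    have := (abs_le.1 hh).2
    linarith
  obtain ⟨h1, h2⟩ := abs_le.1 hs
  by_contra! hcon
  rcases hu with hu | hu <;>
  · have := hu a
    try simp only [Pi.neg_apply] at this
    rcases lt_abs.1 this with h3 | h3 <;> linarith

lemma alignable_of_width_le (hD : 0 ≤ D)
    (h : ∀ p q, |f p - f q| ≤ D ∨ |s p - s q| ≤ D) {a b : ι} (ha : ∀ p, f a ≤ f p)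
    (hb : ∀ p, f p ≤ f b) (hw : f b - f a ≤ 2 * D) : Alignable f s D := by
  have right := fun c => @lt_of_unmatched_of_width_le ι f s D h a b hb hw
    ((f a + f b) / 2) c (by ring)
  have left : ∀ c, c ≤ (f a + f b) / 2 + D / 8 → ∀ p, f p < c - 5 / 8 * D →
      (Unmatched f s D c p ∨ Unmatched f (-s) D c p) →
      (f a + f b) / 2 - 3 / 4 * D + 2 * (c - (f a + f b) / 2) < f p := by
    intro c hc p hp hu
    have := @lt_of_unmatched_of_width_le ι (-f) (-s) D (abs_sub_neg_le_or h) b a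
      (fun p => neg_le_neg (ha p)) (by simp only [Pi.neg_apply]; linarith)
      (-((f a + f b) / 2)) (-c) (by simp only [Pi.neg_apply]; ring) (by linarith) p
      (by simp only [Pi.neg_apply]; linarith) (hu.imp Unmatched.neg_neg Unmatched.neg_neg)
    simp only [Pi.neg_apply] at this
    linarith
  refine ⟨(f a + f b) / 2, D / 8, by positivity, fun p hp hu => ?_, fun p hp hu => ?_, ?_⟩
  · have := right _ le_rfl hp hu
    linarith
  · have := left _ le_rfl p hp hu
    linarith
  · rintro c ⟨hc1, hc2⟩ p q hp hq hu hu'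
    have hr := right c hc1 hp hu
    have hl := left c hc2 q hq hu'
    have hs : |s p - s q| ≤ D := by
      refine (h p q).resolve_left fun hh => ?_
      have := (abs_le.1 hh).2
      linarith
    obtain ⟨h1, h2⟩ := abs_le.1 hs
    rcases hu with hu | hu <;>
    · have := hu q
      try simp only [Pi.neg_apply] at this
      rcases lt_abs.1 this with h3 | h3 <;> linarith

lemma unmatched_and_lt_of_windmill
    (h : ∀ p q, |f p - f q| ≤ D ∨ |s p - s q| ≤ D) {a b u v : ι}
    (hb : ∀ p, f p ≤ f b)
    {m e c : ℝ} (he : 0 ≤ e) (hm : 2 * m = f a + f b) (hw : f b - f a = 2 * D + 2 * e)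
    (hh : 2 * D + 2 * e ≤ s v - s u)
    (hab : |s a - s b| ≤ D) (huv : |f u - f v| ≤ D) (hau : |f a - f u| ≤ D)
    (hbv : |f b - f v| ≤ D) (hav : |s a - s v| ≤ D) (hbu : |s b - s u| ≤ D)
    (hc : m - (D / 8 + e) ≤ c) (hc' : c ≤ m + (D / 8 + e)) {p : ι}
    (hp : c + 5 / 8 * D < f p)
    (hu : Unmatched f s D c p ∨ Unmatched f (-s) D c p) :
    Unmatched f s D c p ∧ f p < m + 3 / 4 * D + e + 2 * (c - m) := by
  have hpb := hb p
  rw [abs_le] at hab huv hau hbv hav hbu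
  obtain ⟨hab1, hab2⟩ := hab
  obtain ⟨huv1, huv2⟩ := huv
  obtain ⟨hau1, hau2⟩ := hau
  obtain ⟨hbv1, hbv2⟩ := hbv
  obtain ⟨hav1, hav2⟩ := hav
  obtain ⟨hbu1, hbu2⟩ := hbu
  have hs : |s p - s a| ≤ D := by
    refine (h p a).resolve_left fun hh => ?_
    have := (abs_le.1 hh).2
    linarith
  obtain ⟨h1, h2⟩ := abs_le.1 hs
  have near : m + 5 / 4 * D + e + 2 * (c - m) < f p → s p - s u ≤ D := by
    intro hlt
    refine (abs_le.1 ((h p u).resolve_left fun hh => ?_)).2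
    have := (abs_le.1 hh).2
    linarith
  rcases hu with hu | hu
  · refine ⟨hu, ?_⟩
    by_contra! hcon
    rcases lt_abs.1 (hu a) with h3 | h3
    · have := near (by linarith)
      linarith
    · linarith
  · exfalso
    have hua := hu a
    have hub := hu b
    have huu := hu u
    simp only [Pi.neg_apply] at hua hub huu
    rcases lt_abs.1 hua with h3 | h3
    · have := near (by linarith)
      rcases lt_abs.1 huu with h4 | h4 <;> linarith
    · rcases lt_abs.1 hub with h4 | h4 <;> linarith

lemma alignable_of_windmill (hD : 0 ≤ D)
    (h : ∀ p q, |f p - f q| ≤ D ∨ |s p - s q| ≤ D) {a b u v : ι}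
    (ha : ∀ p, f a ≤ f p) (hb : ∀ p, f p ≤ f b)
    (hw : 2 * D ≤ f b - f a) (hh : f b - f a ≤ s v - s u)
    (hab : |s a - s b| ≤ D) (huv : |f u - f v| ≤ D) (hau : |f a - f u| ≤ D)
    (hbv : |f b - f v| ≤ D) (hav : |s a - s v| ≤ D) (hbu : |s b - s u| ≤ D) :
    Alignable f s D := by
  obtain ⟨e, he⟩ : ∃ e, f b - f a = 2 * D + 2 * e := ⟨(f b - f a - 2 * D) / 2, by ring⟩
  obtain ⟨m, hm⟩ : ∃ m, 2 * m = f a + f b := ⟨(f a + f b) / 2, by ring⟩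
  have he0 : 0 ≤ e := by linarith
  have right := fun c => @unmatched_and_lt_of_windmill ι f s D h a b u v hb m e c he0 hm he
    (by linarith) hab huv hau hbv hav hbu
  have left : ∀ c, m - (D / 8 + e) ≤ c → c ≤ m + (D / 8 + e) → ∀ p, f p < c - 5 / 8 * D →
      (Unmatched f s D c p ∨ Unmatched f (-s) D c p) →
      Unmatched f s D c p ∧ m - 3 / 4 * D - e + 2 * (c - m) < f p := by
    intro c hc hc' p hp hu
    have := @unmatched_and_lt_of_windmill ι (-f) (-s) D (abs_sub_neg_le_or h) b a v u
      (fun p => neg_le_neg (ha p)) (-m) e (-c) he0 (by simp only [Pi.neg_apply]; linarith)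
      (by simp only [Pi.neg_apply]; linarith) (by simp only [Pi.neg_apply]; linarith)
      (by simpa only [Pi.neg_apply, neg_sub_neg] using hab)
      (by simpa only [Pi.neg_apply, neg_sub_neg] using huv)
      (by simpa only [Pi.neg_apply, neg_sub_neg, abs_sub_comm] using hbv)
      (by simpa only [Pi.neg_apply, neg_sub_neg, abs_sub_comm] using hau)
      (by simpa only [Pi.neg_apply, neg_sub_neg, abs_sub_comm] using hbu)
      (by simpa only [Pi.neg_apply, neg_sub_neg, abs_sub_comm] using hav)
      (by linarith) (by linarith) p
      (by simp only [Pi.neg_apply]; linarith) (hu.imp Unmatched.neg_neg Unmatched.neg_neg)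
    obtain ⟨hu', hlt⟩ := this
    have hu'' := hu'.neg_neg
    rw [neg_neg, neg_neg, neg_neg] at hu''
    simp only [Pi.neg_apply] at hlt
    exact ⟨hu'', by linarith⟩
  refine ⟨m, D / 8 + e, by positivity, fun p hp hu => ?_, fun p hp hu => ?_, ?_⟩
  · have := (right _ le_rfl (by linarith) hp hu).2
    linarith
  · have := (left _ (by linarith) le_rfl p hp hu).2
    linarith
  · rintro c ⟨hc1, hc2⟩ p q hp hq hu hu'
    obtain ⟨hup, hr⟩ := right c hc1 hc2 hp hu
    obtain ⟨huq, hl⟩ := left c hc1 hc2 q hq hu'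
    have hs : |s p - s q| ≤ D := by
      refine (h p q).resolve_left fun hh => ?_
      have := (abs_le.1 hh).2
      linarith
    obtain ⟨h1, h2⟩ := abs_le.1 hs
    obtain ⟨h3, h4⟩ := abs_le.1 hab
    obtain ⟨h5, h6⟩ := abs_le.1 huv
    obtain ⟨h7, h8⟩ := abs_le.1 hau
    obtain ⟨h9, h10⟩ := abs_le.1 hbv
    rcases lt_abs.1 (hup q) with h3 | h3 <;> rcases lt_abs.1 (huq p) with h4 | h4 <;> linarith

lemma alignable_or_alignable (hD : 0 ≤ D)
    (h : ∀ p q, |f p - f q| ≤ D ∨ |s p - s q| ≤ D) {a b u v : ι}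
    (ha : ∀ p, f a ≤ f p) (hb : ∀ p, f p ≤ f b) (hu : ∀ p, s u ≤ s p) (hv : ∀ p, s p ≤ s v) :
    Alignable f s D ∨ Alignable s f D := by
  have h' : ∀ p q, |s p - s q| ≤ D ∨ |f p - f q| ≤ D := fun p q => (h p q).symm
  rcases le_or_gt (f b - f a) (2 * D) with hw | hw
  · exact .inl (alignable_of_width_le hD h ha hb hw)
  rcases le_or_gt (s v - s u) (2 * D) with hh | hh
  · exact .inr (alignable_of_width_le hD h' hu hv hh)
  have notf : ∀ p, |f a - f p| ≤ D → ¬ |f b - f p| ≤ D := fun p h1 h2 => by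
    rw [abs_le] at h1 h2; linarith
  have nots : ∀ p, |s u - s p| ≤ D → ¬ |s v - s p| ≤ D := fun p h1 h2 => by
    rw [abs_le] at h1 h2; linarith
  have hab : |s a - s b| ≤ D := (h a b).resolve_left fun h1 => by rw [abs_le] at h1; linarith
  have huv : |f u - f v| ≤ D := (h u v).resolve_right fun h1 => by rw [abs_le] at h1; linarith
  rcases h a u with hau | hau
  · have hbu : |s b - s u| ≤ D := (h b u).resolve_left (notf u hau)
    have hbv : |f b - f v| ≤ D := (h b v).resolve_right fun h1 =>
      nots b (by rwa [abs_sub_comm]) (by rwa [abs_sub_comm])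
    have hav : |s a - s v| ≤ D := (h a v).resolve_left fun h1 => notf v h1 hbv
    rcases le_total (f b - f a) (s v - s u) with hle | hle
    · exact .inl (alignable_of_windmill hD h ha hb hw.le hle hab huv hau hbv hav hbu)
    · refine .inr (Alignable.of_neg (alignable_of_windmill (a := u) (b := v) (u := b) (v := a)
        hD (fun p q => ?_) hu hv hh.le ?_ ?_ ?_ ?_ ?_ ?_ ?_)) <;>
        (try simp only [Pi.neg_apply, neg_sub_neg]) <;>
        first | exact h' p q | linarith | assumption | (rw [abs_sub_comm]; assumption) | skip
      rw [abs_sub_comm (f q)]; exact h' p q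
  · have hav : |f a - f v| ≤ D := (h a v).resolve_right fun h1 =>
      nots a (by rwa [abs_sub_comm]) (by rwa [abs_sub_comm])
    have hbv : |s b - s v| ≤ D := (h b v).resolve_left (notf v hav)
    have hbu : |f b - f u| ≤ D := (h b u).resolve_right fun h1 =>
      nots b (by rwa [abs_sub_comm]) (by rwa [abs_sub_comm])
    rcases le_total (f b - f a) (s v - s u) with hle | hle
    · refine .inl (Alignable.of_neg (alignable_of_windmill (a := a) (b := b) (u := v) (v := u)
        hD (fun p q => ?_) ha hb hw.le ?_ ?_ ?_ ?_ ?_ ?_ ?_)) <;>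
        (try simp only [Pi.neg_apply, neg_sub_neg]) <;>
        first | linarith | assumption | (rw [abs_sub_comm]; assumption) | skip
      rw [abs_sub_comm (s q)]; exact h p q
    · refine .inr (alignable_of_windmill (a := u) (b := v) (u := a) (v := b)
        hD h' hu hv hh.le hle ?_ ?_ ?_ ?_ ?_ ?_) <;>
        first | assumption | (rw [abs_sub_comm]; assumption)

end

lemma Alignable.exists_hausdorffDist_le {ι : Type*} [Nonempty ι] {x y : ι → ℝ} {D : ℝ}
    (hD : 0 ≤ D) (h : Alignable (x - y) (x + y) D) :
    ∃ c : ℝ, Metric.hausdorffDist (Set.range x) ((fun t => t + c) '' Set.range y) ≤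
      5 / 8 * D := by
  obtain ⟨m, τ, hτ, h1, h2, h3⟩ := h
  let B : ι → Set ℝ := fun p => {c | 5 / 8 * D < Metric.infDist (x p - c) (Set.range y)} ∪
    {c | 5 / 8 * D < Metric.infDist (y p + c) (Set.range x)}
  have hBopen : ∀ p, IsOpen (B p) := fun p =>
    (isOpen_lt continuous_const ((Metric.continuous_infDist_pt _).comp (by fun_prop))).union
      (isOpen_lt continuous_const ((Metric.continuous_infDist_pt _).comp (by fun_prop)))
  have hB : ∀ p, ∀ c ∈ B p,
      Unmatched (x - y) (x + y) D c p ∨ Unmatched (x - y) (-(x + y)) D c p := by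
    rintro p c (hc | hc)
    · refine .inl fun q => ?_
      have hq := lt_of_lt_of_le hc (Metric.infDist_le_dist_of_mem (Set.mem_range_self q))
      rw [Real.dist_eq, lt_abs] at hq
      simp only [Pi.sub_apply, Pi.add_apply]
      rw [lt_abs]
      exact hq.imp (fun _ => by linarith) (fun _ => by linarith)
    · refine .inr fun q => ?_
      have hq := lt_of_lt_of_le hc (Metric.infDist_le_dist_of_mem (Set.mem_range_self q))
      rw [Real.dist_eq, lt_abs] at hq
      simp only [Pi.sub_apply, Pi.add_apply, Pi.neg_apply]
      rw [lt_abs]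
      exact hq.symm.imp (fun _ => by linarith) (fun _ => by linarith)
  let R : Set ℝ := ⋃ p, {c | c + 5 / 8 * D < (x - y) p} ∩ B p
  let L : Set ℝ := ⋃ p, {c | (x - y) p < c - 5 / 8 * D} ∩ B p
  have hR : IsOpen R := isOpen_iUnion fun p =>
    (isOpen_lt (by fun_prop) continuous_const).inter (hBopen p)
  have hL : IsOpen L := isOpen_iUnion fun p =>
    (isOpen_lt continuous_const (by fun_prop)).inter (hBopen p)
  have hRL : ∀ p, ∀ c ∈ B p, c ∈ R ∪ L := by
    intro p c hc
    have hself : 5 / 8 * D < |(x - y) p - c| := by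
      have : 5 / 4 * D < |2 * ((x - y) p - c)| := by
        rcases hB p c hc with hu | hu <;>
        · have := hu p
          rw [sub_self, add_zero] at this
          convert this using 2
          ring
      rw [abs_mul, abs_two] at this
      linarith
    rcases lt_abs.1 hself with hlt | hlt
    · exact .inl (Set.mem_iUnion.2 ⟨p, show c + 5 / 8 * D < (x - y) p by linarith, hc⟩)
    · exact .inr (Set.mem_iUnion.2 ⟨p, show (x - y) p < c - 5 / 8 * D by linarith, hc⟩)
  obtain ⟨c, hc⟩ : ∃ c, ∀ p, c ∉ B p := by
    by_contra! hcon
    have hcov : ∀ c, c ∈ R ∪ L := fun c => (hcon c).elim fun p hp => hRL p c hp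
    have hRleft : m - τ ∉ R := fun hm => by
      obtain ⟨p, hp, hb⟩ := Set.mem_iUnion.1 hm
      exact h1 p hp (hB p _ hb)
    have hLright : m + τ ∉ L := fun hm => by
      obtain ⟨p, hp, hb⟩ := Set.mem_iUnion.1 hm
      exact h2 p hp (hB p _ hb)
    obtain ⟨c, hcI, hcR, hcL⟩ := isPreconnected_Icc (a := m - τ) (b := m + τ) R L hR hL
      (fun c _ => hcov c)
      ⟨m + τ, ⟨by linarith, le_rfl⟩, (hcov _).resolve_right hLright⟩
      ⟨m - τ, ⟨le_rfl, by linarith⟩, (hcov _).resolve_left hRleft⟩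
    obtain ⟨p, hp, hbp⟩ := Set.mem_iUnion.1 hcR
    obtain ⟨q, hq, hbq⟩ := Set.mem_iUnion.1 hcL
    exact h3 c hcI p q hp hq (hB p c hbp) (hB q c hbq)
  refine ⟨c, Metric.hausdorffDist_le_of_infDist (by positivity) ?_ ?_⟩
  · rintro _ ⟨p, rfl⟩
    have := Metric.infDist_image (IsometryEquiv.addRight c).isometry
      (x := x p - c) (t := Set.range y)
    simp only [IsometryEquiv.addRight_apply, sub_add_cancel] at this
    rw [this]
    exact not_lt.1 fun hlt => hc p (.inl hlt)
  · rintro _ ⟨_, ⟨p, rfl⟩, rfl⟩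
    exact not_lt.1 fun hlt => hc p (.inr hlt)

lemma abs_sub_le_or_abs_add_le {a b D : ℝ} (h : |(|a| - |b|)| ≤ D) :
    |a - b| ≤ D ∨ |a + b| ≤ D := by
  rcases abs_cases a with ⟨ha, _⟩ | ⟨ha, _⟩ <;> rcases abs_cases b with ⟨hb, _⟩ | ⟨hb, _⟩ <;>
    rw [ha, hb] at h <;> rw [abs_le] at h <;> simp only [abs_le]
  · exact .inl ⟨by linarith, by linarith⟩
  · exact .inr ⟨by linarith, by linarith⟩
  · exact .inr ⟨by linarith, by linarith⟩
  · exact .inl ⟨by linarith, by linarith⟩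

theorem exists_isometry_hausdorffDist_le (X Y : Set ℝ) (C : Set (ℝ × ℝ)) (D : ℝ)
    (hX : IsCompact X) (hXn : X.Nonempty) (hY : IsCompact Y) (hYn : Y.Nonempty)
    (hC : IsCorrOn X Y C)
    (hD : ∀ p ∈ C, ∀ q ∈ C, abs (|p.1 - q.1| - |p.2 - q.2|) ≤ D) :
    ∃ ε c : ℝ, (ε = 1 ∨ ε = -1) ∧
      Metric.hausdorffDist X ((fun t => ε * t + c) '' Y) ≤ (5 / 8) * D := by
  obtain ⟨hsub, hCX, hCY⟩ := hC
  have hclsub : closure C ⊆ X ×ˢ Y := closure_minimal hsub (hX.isClosed.prod hY.isClosed)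
  have hcomp : IsCompact (closure C) := (hX.prod hY).of_isClosed_subset isClosed_closure hclsub
  have hDcl : ∀ p ∈ closure C, ∀ q ∈ closure C, |(|p.1 - q.1| - |p.2 - q.2|)| ≤ D := by
    have hclosed : IsClosed {z : (ℝ × ℝ) × (ℝ × ℝ) |
        |(|z.1.1 - z.2.1| - |z.1.2 - z.2.2|)| ≤ D} := isClosed_le (by fun_prop) continuous_const
    have := closure_minimal (s := C ×ˢ C) (fun z hz => hD z.1 hz.1 z.2 hz.2) hclosed
    rw [closure_prod_eq] at this
    exact fun p hp q hq => this (Set.mk_mem_prod hp hq)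
  obtain ⟨x₀, hx₀⟩ := hXn
  obtain ⟨y₀, hxy₀⟩ := hCX x₀ hx₀
  have hD0 : 0 ≤ D := (abs_nonneg _).trans (hD _ hxy₀ _ hxy₀)
  have : Nonempty (closure C) := ⟨⟨_, subset_closure hxy₀⟩⟩
  have : CompactSpace (closure C) := isCompact_iff_compactSpace.1 hcomp
  let x : closure C → ℝ := fun p => p.1.1
  let y : closure C → ℝ := fun p => p.1.2
  have hx : Set.range x = X := Set.Subset.antisymm
    (by rintro _ ⟨p, rfl⟩; exact (hclsub p.2).1)
    (fun t ht => (hCX t ht).elim fun t' h => ⟨⟨_, subset_closure h⟩, rfl⟩)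
  have hy : Set.range y = Y := Set.Subset.antisymm
    (by rintro _ ⟨p, rfl⟩; exact (hclsub p.2).2)
    (fun t ht => (hCY t ht).elim fun t' h => ⟨⟨_, subset_closure h⟩, rfl⟩)
  have hxc : Continuous x := by fun_prop
  have hyc : Continuous y := by fun_prop
  have hfs : ∀ p q, |(x - y) p - (x - y) q| ≤ D ∨ |(x + y) p - (x + y) q| ≤ D := by
    intro p q
    have := abs_sub_le_or_abs_add_le (hDcl p p.2 q q.2)
    simp only [Pi.sub_apply, Pi.add_apply]
    rwa [sub_sub_sub_comm, add_sub_add_comm]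
  obtain ⟨a, -, ha⟩ := isCompact_univ.exists_isMinOn Set.univ_nonempty (hxc.sub hyc).continuousOn
  obtain ⟨b, -, hb⟩ := isCompact_univ.exists_isMaxOn Set.univ_nonempty (hxc.sub hyc).continuousOn
  obtain ⟨u, -, hu⟩ := isCompact_univ.exists_isMinOn Set.univ_nonempty (hxc.add hyc).continuousOn
  obtain ⟨v, -, hv⟩ := isCompact_univ.exists_isMaxOn Set.univ_nonempty (hxc.add hyc).continuousOn
  rcases alignable_or_alignable hD0 hfs (fun p => ha (Set.mem_univ p))
    (fun p => hb (Set.mem_univ p)) (fun p => hu (Set.mem_univ p))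
    (fun p => hv (Set.mem_univ p)) with h | h
  · obtain ⟨c, hc⟩ := h.exists_hausdorffDist_le hD0
    refine ⟨1, c, .inl rfl, ?_⟩
    rw [hx, hy] at hc
    simpa only [one_mul] using hc
  · obtain ⟨c, hc⟩ := Alignable.exists_hausdorffDist_le (x := x) (y := -y) hD0
      (by rwa [sub_neg_eq_add, ← sub_eq_add_neg])
    refine ⟨-1, c, .inr rfl, ?_⟩
    have himage : (fun t => t + c) '' Set.range (-y) = (fun t => -1 * t + c) '' Y := by
      rw [← hy, ← Set.range_comp, ← Set.range_comp]
      congr 1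
      ext p
      simp
    rwa [hx, himage] at hc
end

section
/- Let C be a correspondence between compact X, Y ⊆ ℝ with distortion D, in standard configuration with designated edges (x',y'), (x,y) (x' ≤ x, x' − y' = y − x = D/2). If C contains no edge that crosses both designated edges, then there exists Δ ∈ ℝ such that d_H(X, Y + Δ) ≤ (5/8)·D. -/
/-- Every pair of elements of `C` has distortion at most `2`. -/
def DistortionLeTwo (C : Set (ℝ × ℝ)) : Prop :=
  ∀ p q a b : ℝ, (p, q) ∈ C → (a, b) ∈ C → |(|p - a| - |q - b|)| ≤ 2

/-- After shifting the second coordinates by `-s`, each coordinate of an element of `C` is within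
`5 / 4` of an opposite coordinate of some element of `C`. -/
def IsGoodShift (C : Set (ℝ × ℝ)) (s : ℝ) : Prop :=
  ∀ p q : ℝ, (p, q) ∈ C →
    (∃ a b, (a, b) ∈ C ∧ |p - (b - s)| ≤ 5 / 4) ∧ (∃ a b, (a, b) ∈ C ∧ |a - (q - s)| ≤ 5 / 4)

theorem DistortionLeTwo.cross {C : Set (ℝ × ℝ)} (hd : DistortionLeTwo C) {p q a b : ℝ}
    (h : (p, q) ∈ C) (h' : (a, b) ∈ C) (hr : 2 < (p - q) + (b - a)) :
    a < p ∧ q < b ∧ p + q ≤ a + b + 2 ∧ a + b - 2 ≤ p + q := by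
  have key := abs_le.1 (hd p q a b h h')
  rcases abs_cases (p - a) with ⟨h1, h2⟩ | ⟨h1, h2⟩ <;>
    rcases abs_cases (q - b) with ⟨h3, h4⟩ | ⟨h3, h4⟩ <;> rw [h1, h3] at key <;>
    obtain ⟨k1, k2⟩ := key <;>
    refine ⟨?_, ?_, ?_, ?_⟩ <;> by_contra! hcon <;> linarith

theorem DistortionLeTwo.cross_base {C : Set (ℝ × ℝ)} (hd : DistortionLeTwo C)
    (h0 : ((0 : ℝ), (-1 : ℝ)) ∈ C) {a b : ℝ} (h : (a, b) ∈ C) (hm : 1 < b - a) :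
    a < 0 ∧ -1 < b ∧ -3 ≤ a + b ∧ a + b ≤ 1 := by
  obtain ⟨h1, h2, h3, h4⟩ := hd.cross h0 h (by linarith)
  exact ⟨h1, h2, by linarith, by linarith⟩

/-- If the first coordinate of an edge far above the diagonal is isolated, a good shift exists. -/
theorem exists_isGoodShift_of_isolated_fst {C : Set (ℝ × ℝ)} (hc : IsCompact C)
    (hd : DistortionLeTwo C) (h0 : ((0 : ℝ), (-1 : ℝ)) ∈ C)
    (h3 : ∀ p q : ℝ, (p, q) ∈ C → q - p ≤ 3)
    (hB : ∀ p q : ℝ, (p, q) ∈ C →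
      p - q ≤ 1 ∨ (-1 ≤ q ∧ ∃ l, 0 ≤ l ∧ l ≤ p ∧ (l, l + 1) ∈ C))
    {p0 q0 : ℝ} (he0 : (p0, q0) ∈ C) (hp0 : p0 < -9 / 4)
    (hiso : ∀ p q : ℝ, (p, q) ∈ C → 5 / 4 < |p0 - q|) : ∃ s, IsGoodShift C s := by
  have hm0 : 5 / 4 < q0 - p0 := by
    rcases lt_abs.1 (hiso _ _ he0) with h | h
    · rcases hB _ _ he0 with h' | ⟨h', -⟩ <;> linarith
    · linarith
  obtain ⟨-, -, a3, a4⟩ := hd.cross_base h0 he0 (by linarith)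
  have a5 := h3 _ _ he0
  -- edges below the diagonal that cross `(p0, q0)`
  have hlow : ∀ p q : ℝ, (p, q) ∈ C → 2 < (p - q) + (q0 - p0) →
      p0 < p ∧ q < q0 ∧ p + q ≤ p0 + q0 + 2 ∧ p0 + q0 - 2 ≤ p + q ∧ p0 + 5 / 4 < q ∧
        (p - q ≤ 1 ∨ (-1 ≤ q ∧ p ≤ p0 + q0 + 3 ∧ ∃ l, 0 ≤ l ∧ l ≤ p ∧ (l, l + 1) ∈ C)) := by
    intro p q h hr
    obtain ⟨c1, c2, c3, c4⟩ := hd.cross h he0 hr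
    refine ⟨c1, c2, c3, c4, ?_, ?_⟩
    · rcases lt_abs.1 (hiso _ _ h) with h' | h'
      · rcases hB _ _ h with h'' | ⟨h'', -⟩ <;> linarith
      · linarith
    · rcases hB _ _ h with h' | ⟨h', l⟩
      · exact Or.inl h'
      · exact Or.inr ⟨h', by linarith, l⟩
  -- reduction to the edges that the shift does not already make short
  have reduce : ∀ s : ℝ,
      (∀ p q : ℝ, (p, q) ∈ C → 5 / 4 + s < q - p →
        (∃ a b, (a, b) ∈ C ∧ |p - (b - s)| ≤ 5 / 4) ∧
          (∃ a b, (a, b) ∈ C ∧ |a - (q - s)| ≤ 5 / 4)) →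
      (∀ p q : ℝ, (p, q) ∈ C → 5 / 4 - s < p - q →
        (∃ a b, (a, b) ∈ C ∧ |p - (b - s)| ≤ 5 / 4) ∧
          (∃ a b, (a, b) ∈ C ∧ |a - (q - s)| ≤ 5 / 4)) → ∃ s, IsGoodShift C s := by
    intro s hh hl
    refine ⟨s, fun p q h => ?_⟩
    by_cases h1 : 5 / 4 + s < q - p
    · exact hh p q h h1
    by_cases h2 : 5 / 4 - s < p - q
    · exact hl p q h h2
    have : |p - (q - s)| ≤ 5 / 4 := abs_le.2 ⟨by linarith, by linarith⟩
    exact ⟨⟨p, q, h, this⟩, ⟨p, q, h, this⟩⟩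
  obtain ⟨⟨p1, q1⟩, he1, hmax⟩ := hc.exists_isMaxOn ⟨_, h0⟩
    (f := fun e : ℝ × ℝ => e.2 - e.1) (by fun_prop)
  have hM : ∀ p q : ℝ, (p, q) ∈ C → q - p ≤ q1 - p1 := fun p q h => hmax h
  have hM0 := hM _ _ he0
  have hM3 := h3 _ _ he1
  obtain ⟨b1, b2, b3, b4⟩ := hd.cross_base h0 he1 (by linarith)
  rcases lt_or_ge (q1 - p1) 2 with hM2 | hM2
  · refine reduce (q1 - p1 - 5 / 4) (fun p q h hh => ?_) (fun p q h hl => ?_)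
    · have := hM _ _ h
      linarith
    · obtain ⟨c1, c2, c3, c4⟩ := hd.cross h he1 (by linarith)
      obtain ⟨-, -, -, -, -, c5⟩ := hlow p q h (by linarith)
      constructor
      · rcases c5 with c5 | ⟨-, c6, l, l0, l1, l2⟩
        · exact ⟨_, _, he1, abs_le.2 ⟨by linarith, by linarith⟩⟩
        · exact ⟨_, _, l2, abs_le.2 ⟨by linarith, by linarith⟩⟩
      · refine ⟨_, _, he1, abs_le.2 ⟨by linarith, ?_⟩⟩
        rcases c5 with c5 | ⟨c5, -⟩ <;> linarith
  rcases lt_or_ge p0 (-5 / 2) with hp | hp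
  · have hcK : IsCompact (C ∩ {e : ℝ × ℝ | 2 ≤ e.2 - e.1}) :=
      hc.inter_right (isClosed_le (by fun_prop) (by fun_prop))
    obtain ⟨⟨p2, q2⟩, ⟨he2, hm2⟩, hmin⟩ := hcK.exists_isMinOn
      ⟨(p0, q0), he0, show 2 ≤ q0 - p0 by linarith⟩ (f := fun e : ℝ × ℝ => e.2) (by fun_prop)
    replace hm2 : 2 ≤ q2 - p2 := hm2
    have hq2 : ∀ p q : ℝ, (p, q) ∈ C → 2 ≤ q - p → q2 ≤ q := fun p q h h' => hmin ⟨h, h'⟩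
    obtain ⟨d1, d2, d3, d4⟩ := hd.cross_base h0 he2 (by linarith)
    have d5 := h3 _ _ he2
    obtain ⟨t, ht1, ht2, ht3⟩ :
        ∃ t : ℝ, 3 / 4 ≤ t ∧ q0 - p0 - 7 / 4 ≤ t ∧ (t = 3 / 4 ∨ t = q0 - p0 - 7 / 4) :=
      ⟨max (3 / 4) (q0 - p0 - 7 / 4), le_max_left _ _, le_max_right _ _, max_choice _ _⟩
    rcases le_or_gt (t - 5 / 4) q2 with hqt | hqt
    · refine reduce t (fun p q h hh => ?_) (fun p q h hl => ?_)
      · obtain ⟨c1, c2, c3, c4⟩ := hd.cross_base h0 h (by linarith)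
        have c5 := h3 _ _ h
        have c6 := hq2 _ _ h (by linarith)
        constructor
        · rcases le_or_gt p (1 / 4 - t) with hpt | hpt
          · exact ⟨_, _, h0, abs_le.2 ⟨by linarith, by linarith⟩⟩
          · refine ⟨_, _, he0, abs_le.2 ⟨by linarith, ?_⟩⟩
            rcases ht3 with ht3 | ht3 <;> linarith
        · exact ⟨_, _, h0, abs_le.2 ⟨by linarith, by linarith⟩⟩
      · have ht4 : t ≤ 5 / 4 := by rcases ht3 with ht3 | ht3 <;> linarith
        obtain ⟨c1, c2, c3, c4, c5, c6⟩ := hlow p q h (by linarith)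
        constructor
        · rcases c6 with c6 | ⟨-, c7, l, l0, l1, l2⟩
          · refine ⟨_, _, he0, abs_le.2 ⟨by linarith, ?_⟩⟩
            rcases ht3 with ht3 | ht3 <;> linarith
          · exact ⟨_, _, l2, abs_le.2 ⟨by linarith, by linarith⟩⟩
        · exact ⟨_, _, he0, abs_le.2 ⟨by linarith, by linarith⟩⟩
    · have ht4 : t = q0 - p0 - 7 / 4 := by
        rcases ht3 with ht3 | ht3
        · linarith
        · exact ht3
      refine reduce (q2 + 5 / 4) (fun p q h hh => ?_) (fun p q h hl => ?_)
      · obtain ⟨c1, c2, c3, c4⟩ := hd.cross_base h0 h (by linarith)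
        have c5 := h3 _ _ h
        have c6 := hq2 _ _ h (by linarith)
        constructor
        · rcases le_or_gt p (1 / 4 - (q2 + 5 / 4)) with hpt | hpt
          · exact ⟨_, _, h0, abs_le.2 ⟨by linarith, by linarith⟩⟩
          · exact ⟨_, _, he2, abs_le.2 ⟨by linarith, by linarith⟩⟩
        · exact ⟨_, _, h0, abs_le.2 ⟨by linarith, by linarith⟩⟩
      · obtain ⟨c1, c2, c3, c4, c5, c6⟩ := hlow p q h (by linarith)
        obtain ⟨-, -, f3, f4⟩ := hd.cross h he2 (by linarith)
        constructor
        · rcases c6 with c6 | ⟨-, c7, l, l0, l1, l2⟩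
          · rcases le_or_gt p (1 / 4 - (q2 + 5 / 4)) with hpt | hpt
            · exact ⟨_, _, h0, abs_le.2 ⟨by linarith, by linarith⟩⟩
            rcases le_or_gt p 0 with hpz | hpz
            · exact ⟨_, _, he2, abs_le.2 ⟨by linarith, by linarith⟩⟩
            · exact ⟨_, _, he0, abs_le.2 ⟨by linarith, by linarith⟩⟩
          · exact ⟨_, _, l2, abs_le.2 ⟨by linarith, by linarith⟩⟩
        · rcases le_or_gt q (p0 + (q2 + 5 / 4) + 5 / 4) with hqt | hqt
          · exact ⟨_, _, he0, abs_le.2 ⟨by linarith, by linarith⟩⟩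
          · exact ⟨_, _, he2, abs_le.2 ⟨by linarith, by linarith⟩⟩
  rcases lt_or_ge (q0 - p0) 2 with hm | hm
  · obtain ⟨t, ht1, ht2, ht3, ht4⟩ : ∃ t : ℝ, 3 / 4 ≤ t ∧ q1 - p1 - 7 / 4 ≤ t ∧
        t ≤ (q1 - p1) / 2 - 1 / 4 ∧ t ≤ 5 / 4 :=
      ⟨max (3 / 4) (q1 - p1 - 7 / 4), le_max_left _ _, le_max_right _ _,
        max_le (by linarith) (by linarith), max_le (by linarith) (by linarith)⟩
    refine reduce t (fun p q h hh => ?_) (fun p q h hl => ?_)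
    · obtain ⟨c1, c2, c3, c4⟩ := hd.cross_base h0 h (by linarith)
      have c5 := h3 _ _ h
      constructor
      · rcases le_or_gt p (1 / 4 - t) with hpt | hpt
        · exact ⟨_, _, h0, abs_le.2 ⟨by linarith, by linarith⟩⟩
        · exact ⟨_, _, he0, abs_le.2 ⟨by linarith, by linarith⟩⟩
      · rcases le_or_gt (t - 5 / 4) q with hqt | hqt
        · exact ⟨_, _, h0, abs_le.2 ⟨by linarith, by linarith⟩⟩
        · exact ⟨_, _, he0, abs_le.2 ⟨by linarith, by linarith⟩⟩
    · obtain ⟨c1, c2, c3, c4⟩ := hd.cross h he1 (by linarith)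
      constructor
      · rcases le_or_gt (p - q) 1 with hr | hr
        · exact ⟨_, _, he1, abs_le.2 ⟨by linarith, by linarith⟩⟩
        · obtain ⟨-, -, c3, -, -, c6⟩ := hlow p q h (by linarith)
          rcases c6 with c6 | ⟨-, c7, l, l0, l1, l2⟩
          · linarith
          · exact ⟨_, _, l2, abs_le.2 ⟨by linarith, by linarith⟩⟩
      · refine ⟨_, _, he1, abs_le.2 ⟨by linarith, ?_⟩⟩
        rcases hB _ _ h with h' | ⟨h', -⟩ <;> linarith
  · refine reduce (3 / 4) (fun p q h hh => ?_) (fun p q h hl => ?_)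
    · obtain ⟨c1, c2, c3, c4⟩ := hd.cross_base h0 h (by linarith)
      have c5 := h3 _ _ h
      exact ⟨⟨_, _, h0, abs_le.2 ⟨by linarith, by linarith⟩⟩,
        ⟨_, _, h0, abs_le.2 ⟨by linarith, by linarith⟩⟩⟩
    · obtain ⟨c1, c2, c3, c4, c5, c6⟩ := hlow p q h (by linarith)
      constructor
      · rcases c6 with c6 | ⟨-, c7, l, l0, l1, l2⟩
        · rcases le_or_gt p (-1 / 2) with hpt | hpt
          · exact ⟨_, _, h0, abs_le.2 ⟨by linarith, by linarith⟩⟩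
          · exact ⟨_, _, he0, abs_le.2 ⟨by linarith, by linarith⟩⟩
        · exact ⟨_, _, l2, abs_le.2 ⟨by linarith, by linarith⟩⟩
      · rcases le_or_gt q (-1 / 2) with hqt | hqt
        · exact ⟨_, _, he0, abs_le.2 ⟨by linarith, by linarith⟩⟩
        · exact ⟨_, _, h0, abs_le.2 ⟨by linarith, by linarith⟩⟩

/-- A compact correspondence of distortion at most `2` with designated edges `(0, -1)` and
`(L, L + 1)`, none of whose edges crosses both of them. -/
structure IsStdConfig (C : Set (ℝ × ℝ)) (L : ℝ) : Prop where
  compact : IsCompact C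
  dist : DistortionLeTwo C
  nonneg : 0 ≤ L
  left_mem : ((0 : ℝ), (-1 : ℝ)) ∈ C
  right_mem : (L, L + 1) ∈ C
  not_cross : ∀ p q : ℝ, (p, q) ∈ C → ¬(p * (q + 1) < 0 ∧ (p - L) * (q - (L + 1)) < 0)

namespace IsStdConfig

variable {C : Set (ℝ × ℝ)} {L : ℝ}

theorem reflect (h : IsStdConfig C L) :
    IsStdConfig ((fun e : ℝ × ℝ => (L - e.1, L - e.2)) '' C) L where
  compact := h.compact.image (by fun_prop)
  dist := by
    rintro _ _ _ _ ⟨⟨p, q⟩, he, h1⟩ ⟨⟨a, b⟩, hf, h2⟩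
    simp only [Prod.mk.injEq] at h1 h2
    obtain ⟨rfl, rfl⟩ := h1
    obtain ⟨rfl, rfl⟩ := h2
    rw [sub_sub_sub_cancel_left, sub_sub_sub_cancel_left]
    exact h.dist a b p q hf he
  nonneg := h.nonneg
  left_mem := ⟨_, h.right_mem, by ext <;> simp⟩
  right_mem := ⟨_, h.left_mem, by ext <;> simp⟩
  not_cross := by
    rintro _ _ ⟨⟨p, q⟩, he, h1⟩
    simp only [Prod.mk.injEq] at h1
    obtain ⟨rfl, rfl⟩ := h1
    rintro ⟨h1, h2⟩
    exact h.not_cross p q he ⟨by linarith, by linarith⟩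

theorem exists_isGoodShift_of_reflect
    (h : ∃ s, IsGoodShift ((fun e : ℝ × ℝ => (L - e.1, L - e.2)) '' C) s) :
    ∃ s, IsGoodShift C s := by
  obtain ⟨s, hs⟩ := h
  refine ⟨-s, fun p q hpq => ?_⟩
  obtain ⟨⟨_, _, ⟨⟨a, b⟩, hab, h1⟩, h2⟩, ⟨_, _, ⟨⟨c, d⟩, hcd, h3⟩, h4⟩⟩ :=
    hs _ _ ⟨(p, q), hpq, rfl⟩
  simp only [Prod.mk.injEq] at h1 h3
  obtain ⟨rfl, rfl⟩ := h1
  obtain ⟨rfl, rfl⟩ := h3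
  rw [abs_le] at h2 h4
  exact ⟨⟨a, b, hab, abs_le.2 ⟨by linarith, by linarith⟩⟩,
    ⟨c, d, hcd, abs_le.2 ⟨by linarith, by linarith⟩⟩⟩

theorem snd_sub_fst_le (h : IsStdConfig C L) {p q : ℝ} (he : (p, q) ∈ C) : q - p ≤ 3 := by
  by_contra! hm
  obtain ⟨h1, h2, -, -⟩ := h.dist.cross_base h.left_mem he (by linarith)
  obtain ⟨h3, h4, -, -⟩ := h.dist.cross h.right_mem he (by linarith)
  exact h.not_cross p q he ⟨mul_neg_of_neg_of_pos h1 (by linarith),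
    mul_neg_of_neg_of_pos (by linarith) (by linarith)⟩

/-- An edge far below the diagonal crosses `(L, L + 1)` and hence does not cross `(0, -1)`. -/
theorem of_one_lt_fst_sub_snd (h : IsStdConfig C L) {p q : ℝ} (he : (p, q) ∈ C)
    (hr : 1 < p - q) : L < p ∧ 2 * L - 1 ≤ p + q ∧ -1 ≤ q := by
  obtain ⟨h1, h2, h3, h4⟩ := h.dist.cross he h.right_mem (by linarith)
  refine ⟨h1, by linarith, ?_⟩
  by_contra! hq
  have := h.nonneg
  exact h.not_cross p q he ⟨mul_neg_of_pos_of_neg (by linarith) (by linarith),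
    mul_neg_of_pos_of_neg (by linarith) (by linarith)⟩

theorem exists_isGoodShift_of_fst (h : IsStdConfig C L) {p q : ℝ} (he : (p, q) ∈ C)
    (hm : 5 / 4 < q - p) (hiso : ∀ a b : ℝ, (a, b) ∈ C → 5 / 4 < |p - b|) :
    ∃ s, IsGoodShift C s := by
  obtain ⟨h1, h2, -, -⟩ := h.dist.cross_base h.left_mem he (by linarith)
  refine exists_isGoodShift_of_isolated_fst h.compact h.dist h.left_mem
    (fun _ _ hab => h.snd_sub_fst_le hab) (fun a b hab => ?_) he ?_ hiso
  · rcases le_or_gt (a - b) 1 with hr | hr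
    · exact Or.inl hr
    · obtain ⟨k1, -, k2⟩ := h.of_one_lt_fst_sub_snd hab hr
      exact Or.inr ⟨k2, L, h.nonneg, k1.le, h.right_mem⟩
  · rcases lt_abs.1 (hiso _ _ h.left_mem) with h' | h' <;> linarith

theorem exists_isGoodShift_of_snd (h : IsStdConfig C L) {p q : ℝ} (he : (p, q) ∈ C)
    (hm : 5 / 4 < q - p) (hiso : ∀ a b : ℝ, (a, b) ∈ C → 5 / 4 < |a - q|) :
    ∃ s, IsGoodShift C s := by
  have hL := h.nonneg
  obtain ⟨h1, h2, -, h4⟩ := h.dist.cross_base h.left_mem he (by linarith)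
  have hq : 5 / 4 < q := by
    rcases lt_abs.1 (hiso _ _ h.left_mem) with h' | h' <;> linarith
  have hqL : q ≤ L + 1 := by
    by_contra! hcon
    exact h.not_cross p q he ⟨mul_neg_of_neg_of_pos h1 (by linarith),
      mul_neg_of_neg_of_pos (by linarith) (by linarith)⟩
  have hL2 : 5 / 2 < L := by
    rcases lt_abs.1 (hiso _ _ h.right_mem) with h' | h' <;> linarith
  have hlow : ∀ a b : ℝ, (a, b) ∈ C → a - b ≤ 1 := by
    intro a b hab
    by_contra! hr
    obtain ⟨-, k2, -⟩ := h.of_one_lt_fst_sub_snd hab hr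
    obtain ⟨-, -, k3, -⟩ := h.dist.cross hab he (by linarith)
    linarith
  obtain ⟨s, hs⟩ : ∃ s, IsGoodShift ((fun e : ℝ × ℝ => (-1 - e.2, -1 - e.1)) '' C) s := by
    refine exists_isGoodShift_of_isolated_fst (h.compact.image (by fun_prop)) ?_
      ⟨_, h.left_mem, by ext <;> simp⟩ ?_ ?_ ⟨_, he, rfl⟩ (by linarith) ?_
    · rintro _ _ _ _ ⟨⟨a, b⟩, hab, k1⟩ ⟨⟨c, d⟩, hcd, k2⟩
      simp only [Prod.mk.injEq] at k1 k2
      obtain ⟨rfl, rfl⟩ := k1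
      obtain ⟨rfl, rfl⟩ := k2
      rw [sub_sub_sub_cancel_left, sub_sub_sub_cancel_left, abs_sub_comm]
      exact h.dist c d a b hcd hab
    · rintro _ _ ⟨⟨a, b⟩, hab, k1⟩
      simp only [Prod.mk.injEq] at k1
      obtain ⟨rfl, rfl⟩ := k1
      have := h.snd_sub_fst_le hab
      linarith
    · rintro _ _ ⟨⟨a, b⟩, hab, k1⟩
      simp only [Prod.mk.injEq] at k1
      obtain ⟨rfl, rfl⟩ := k1
      have := hlow a b hab
      exact Or.inl (by linarith)
    · rintro _ _ ⟨⟨a, b⟩, hab, k1⟩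
      simp only [Prod.mk.injEq] at k1
      obtain ⟨rfl, rfl⟩ := k1
      rw [sub_sub_sub_cancel_left]
      exact hiso a b hab
  refine ⟨s, fun a b hab => ?_⟩
  obtain ⟨⟨_, _, ⟨⟨a', b'⟩, hab', k1⟩, k2⟩, ⟨_, _, ⟨⟨c, d⟩, hcd, k3⟩, k4⟩⟩ :=
    hs _ _ ⟨(a, b), hab, rfl⟩
  simp only [Prod.mk.injEq] at k1 k3
  obtain ⟨rfl, rfl⟩ := k1
  obtain ⟨rfl, rfl⟩ := k3
  rw [abs_le] at k2 k4
  exact ⟨⟨c, d, hcd, abs_le.2 ⟨by linarith, by linarith⟩⟩,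
    ⟨a', b', hab', abs_le.2 ⟨by linarith, by linarith⟩⟩⟩

theorem exists_isGoodShift (h : IsStdConfig C L) : ∃ s, IsGoodShift C s := by
  by_contra hcon
  have h0 : ¬IsGoodShift C 0 := fun h' => hcon ⟨0, h'⟩
  refine h0 fun p q he => ⟨?_, ?_⟩
  · by_contra! hiso
    simp only [sub_zero] at hiso
    rcases lt_abs.1 (hiso p q he) with hr | hm
    · refine hcon (exists_isGoodShift_of_reflect
        (h.reflect.exists_isGoodShift_of_fst ⟨_, he, rfl⟩ (by linarith) ?_))
      rintro _ _ ⟨⟨a, b⟩, hab, k1⟩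
      simp only [Prod.mk.injEq] at k1
      obtain ⟨rfl, rfl⟩ := k1
      rw [sub_sub_sub_cancel_left, abs_sub_comm]
      exact hiso a b hab
    · exact hcon (h.exists_isGoodShift_of_fst he (by linarith) hiso)
  · by_contra! hiso
    simp only [sub_zero] at hiso
    rcases lt_abs.1 (hiso p q he) with hr | hm
    · refine hcon (exists_isGoodShift_of_reflect
        (h.reflect.exists_isGoodShift_of_snd ⟨_, he, rfl⟩ (by linarith) ?_))
      rintro _ _ ⟨⟨a, b⟩, hab, k1⟩
      simp only [Prod.mk.injEq] at k1
      obtain ⟨rfl, rfl⟩ := k1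
      rw [sub_sub_sub_cancel_left, abs_sub_comm]
      exact hiso a b hab
    · exact hcon (h.exists_isGoodShift_of_snd he (by linarith) hiso)

end IsStdConfig

theorem hausdorffDist_le_of_correspondence {X Y : Set ℝ} {C : Set (ℝ × ℝ)}
    (hC : IsCorrOn X Y C) {r Δ : ℝ} (hr : 0 ≤ r)
    (h : ∀ p q : ℝ, (p, q) ∈ C →
      (∃ b ∈ Y, |p - (b + Δ)| ≤ r) ∧ (∃ a ∈ X, |a - (q + Δ)| ≤ r)) :
    Metric.hausdorffDist X ((fun t => t + Δ) '' Y) ≤ r := by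
  refine Metric.hausdorffDist_le_of_mem_dist hr (fun p hp => ?_) ?_
  · obtain ⟨q, hq⟩ := hC.2.1 p hp
    obtain ⟨b, hb, hle⟩ := (h p q hq).1
    exact ⟨_, ⟨b, hb, rfl⟩, hle⟩
  · rintro _ ⟨q, hq, rfl⟩
    obtain ⟨p, hp⟩ := hC.2.2 q hq
    obtain ⟨a, ha, hle⟩ := (h p q hp).2
    exact ⟨a, ha, by rwa [dist_comm]⟩

/-- Closure of a correspondence between compact sets is a correspondence. -/
theorem IsCorrOn.closure {X Y : Set ℝ} {C : Set (ℝ × ℝ)} (hC : IsCorrOn X Y C)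
    (hX : IsClosed X) (hY : IsClosed Y) : IsCorrOn X Y (closure C) :=
  ⟨closure_minimal hC.1 (hX.prod hY),
    fun p hp => (hC.2.1 p hp).imp fun _ h => subset_closure h,
    fun q hq => (hC.2.2 q hq).imp fun _ h => subset_closure h⟩

theorem closure_distortion_le {C : Set (ℝ × ℝ)} {D : ℝ}
    (hdist : ∀ p ∈ C, ∀ q ∈ C, |(|p.1 - q.1| - |p.2 - q.2|)| ≤ D) :
    ∀ p ∈ closure C, ∀ q ∈ closure C, |(|p.1 - q.1| - |p.2 - q.2|)| ≤ D := by
  have h1 : ∀ p ∈ closure C, ∀ q ∈ C, |(|p.1 - q.1| - |p.2 - q.2|)| ≤ D := fun p hp q hq =>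
    closure_minimal (t := {p : ℝ × ℝ | |(|p.1 - q.1| - |p.2 - q.2|)| ≤ D})
      (fun p hp => hdist p hp q hq) (isClosed_le (by fun_prop) (by fun_prop)) hp
  exact fun p hp q hq =>
    closure_minimal (t := {q : ℝ × ℝ | |(|p.1 - q.1| - |p.2 - q.2|)| ≤ D})
      (fun q hq => h1 p hp q hq) (isClosed_le (by fun_prop) (by fun_prop)) hq

theorem closure_not_cross {C : Set (ℝ × ℝ)} {x' y' x y : ℝ}
    (h : ∀ p q : ℝ, (p, q) ∈ C →
      ¬((p - x') * (q - y') < 0 ∧ (p - x) * (q - y) < 0)) (p q : ℝ) (hpq : (p, q) ∈ closure C) :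
    ¬((p - x') * (q - y') < 0 ∧ (p - x) * (q - y) < 0) := by
  have hcl : IsClosed {e : ℝ × ℝ |
      0 ≤ (e.1 - x') * (e.2 - y') ∨ 0 ≤ (e.1 - x) * (e.2 - y)} :=
    IsClosed.union (s₁ := {e : ℝ × ℝ | 0 ≤ (e.1 - x') * (e.2 - y')})
      (s₂ := {e : ℝ × ℝ | 0 ≤ (e.1 - x) * (e.2 - y)})
      (isClosed_le (by fun_prop) (by fun_prop)) (isClosed_le (by fun_prop) (by fun_prop))
  have hmem := closure_minimal (fun e he => ?_) hcl hpq
  · rintro ⟨h1, h2⟩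
    rcases hmem with h' | h'
    · exact absurd h1 (not_lt.2 h')
    · exact absurd h2 (not_lt.2 h')
  · have := h e.1 e.2 he
    by_contra hcon
    rw [Set.mem_ofPred_eq, not_or, not_le, not_le] at hcon
    exact this hcon

theorem isStdConfig_image {C : Set (ℝ × ℝ)} {D x' y' x y : ℝ} (hD : 0 < D) (hc : IsCompact C)
    (hdist : ∀ p ∈ C, ∀ q ∈ C, |(|p.1 - q.1| - |p.2 - q.2|)| ≤ D)
    (hx'y' : (x', y') ∈ C) (hxy : (x, y) ∈ C)
    (hxx : x' ≤ x) (hstd1 : x' - y' = D / 2) (hstd2 : y - x = D / 2)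
    (hnd : ∀ p q : ℝ, (p, q) ∈ C →
      ¬((p - x') * (q - y') < 0 ∧ (p - x) * (q - y) < 0)) :
    IsStdConfig ((fun e : ℝ × ℝ => ((e.1 - x') * (2 / D), (e.2 - x') * (2 / D))) '' C)
      ((x - x') * (2 / D)) where
  compact := hc.image (by fun_prop)
  dist := by
    rintro _ _ _ _ ⟨⟨p, q⟩, he, h1⟩ ⟨⟨a, b⟩, hf, h2⟩
    simp only [Prod.mk.injEq] at h1 h2
    obtain ⟨rfl, rfl⟩ := h1
    obtain ⟨rfl, rfl⟩ := h2
    have hk : (0 : ℝ) < 2 / D := by positivity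
    rw [← sub_mul, ← sub_mul, sub_sub_sub_cancel_right, sub_sub_sub_cancel_right, abs_mul, abs_mul,
      ← sub_mul, abs_mul, abs_abs, abs_of_pos hk]
    calc _ ≤ D * (2 / D) := by
          gcongr
          exact hdist _ he _ hf
      _ = 2 := by field_simp
  nonneg := mul_nonneg (by linarith) (by positivity)
  left_mem := by
    refine ⟨_, hx'y', ?_⟩
    have : y' = x' - D / 2 := by linarith
    ext
    · simp
    · simp only [this]
      field_simp
      ring
  right_mem := by
    refine ⟨_, hxy, ?_⟩
    have : y = x + D / 2 := by linarith
    ext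
    · simp
    · simp only [this]
      field_simp
      ring
  not_cross := by
    rintro _ _ ⟨⟨p, q⟩, he, h1⟩
    simp only [Prod.mk.injEq] at h1
    obtain ⟨rfl, rfl⟩ := h1
    rintro ⟨h1, h2⟩
    have hk : (0 : ℝ) < (2 / D) ^ 2 := by positivity
    have e1 : (p - x') * (2 / D) * ((q - x') * (2 / D) + 1) =
        (2 / D) ^ 2 * ((p - x') * (q - y')) := by
      have : y' = x' - D / 2 := by linarith
      rw [this]
      field_simp
      ring
    have e2 : ((p - x') * (2 / D) - (x - x') * (2 / D)) *
        ((q - x') * (2 / D) - ((x - x') * (2 / D) + 1)) =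
        (2 / D) ^ 2 * ((p - x) * (q - y)) := by
      have : y = x + D / 2 := by linarith
      rw [this]
      field_simp
      ring
    rw [e1] at h1
    rw [e2] at h2
    exact hnd p q he ⟨(pos_iff_neg_of_mul_neg h1).1 hk, (pos_iff_neg_of_mul_neg h2).1 hk⟩

/-- A correspondence without distortion that fixes a point and has no crossing with it is
diagonal. -/
theorem eq_of_distortion_zero {C : Set (ℝ × ℝ)} {x' x : ℝ}
    (hdist : ∀ p ∈ C, ∀ q ∈ C, |(|p.1 - q.1| - |p.2 - q.2|)| ≤ 0)
    (hx' : (x', x') ∈ C) (hx : (x, x) ∈ C)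
    (hnd : ∀ p q : ℝ, (p, q) ∈ C →
      ¬((p - x') * (q - x') < 0 ∧ (p - x) * (q - x) < 0))
    (p q : ℝ) (hpq : (p, q) ∈ C) : p = q := by
  have key : ∀ a, (a, a) ∈ C → ¬(p - a) * (q - a) < 0 → p = q := by
    intro a ha hn
    have h1 : |p - a| = |q - a| := by
      have := abs_nonpos_iff.1 (hdist _ hpq _ ha)
      exact sub_eq_zero.1 this
    rcases abs_eq_abs.1 h1 with h2 | h2
    · linarith
    · rw [h2] at hn
      have : q - a = 0 := by
        by_contra hne
        exact hn (by nlinarith [sq_pos_of_ne_zero hne])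
      linarith
  by_contra hne
  exact hnd p q hpq ⟨by_contra fun h => hne (key x' hx' h), by_contra fun h => hne (key x hx h)⟩

theorem no_double_crossing (X Y : Set ℝ) (C : Set (ℝ × ℝ)) (D : ℝ)
    (hX : IsCompact X) (hY : IsCompact Y) (hC : IsCorrOn X Y C)
    (hdist : ∀ p ∈ C, ∀ q ∈ C, abs (|p.1 - q.1| - |p.2 - q.2|) ≤ D)
    (x' y' x y : ℝ) (hx'y' : (x', y') ∈ C) (hxy : (x, y) ∈ C)
    (hxx : x' ≤ x) (hstd1 : x' - y' = D / 2) (hstd2 : y - x = D / 2)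
    -- no edge crosses both designated edges
    (hnd : ∀ p q : ℝ, (p, q) ∈ C →
      ¬((p - x') * (q - y') < 0 ∧ (p - x) * (q - y) < 0)) :
    ∃ Δ : ℝ, Metric.hausdorffDist X ((fun t => t + Δ) '' Y) ≤ (5 / 8) * D := by
  have hD : 0 ≤ D := (abs_nonneg _).trans (hdist _ hxy _ hxy)
  rcases hD.eq_or_lt with rfl | hD
  · obtain rfl : y' = x' := by linarith
    obtain rfl : y = x := by linarith
    refine ⟨0, hausdorffDist_le_of_correspondence hC (by norm_num) fun p q hpq => ?_⟩
    obtain rfl := eq_of_distortion_zero hdist hx'y' hxy hnd p q hpq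
    exact ⟨⟨p, (hC.1 hpq).2, by simp⟩, ⟨p, (hC.1 hpq).1, by simp⟩⟩
  have hC' := hC.closure hX.isClosed hY.isClosed
  have hcompact : IsCompact (closure C) :=
    (hX.prod hY).of_isClosed_subset isClosed_closure hC'.1
  obtain ⟨s, hs⟩ := (isStdConfig_image hD hcompact (closure_distortion_le hdist)
    (subset_closure hx'y') (subset_closure hxy) hxx hstd1 hstd2
    (closure_not_cross hnd)).exists_isGoodShift
  have scale : ∀ a b : ℝ, |(a - x') * (2 / D) - ((b - x') * (2 / D) - s)| ≤ 5 / 4 →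
      |a - (b + -(s * (D / 2)))| ≤ 5 / 8 * D := by
    intro a b hab
    have e : a - (b + -(s * (D / 2))) =
        ((a - x') * (2 / D) - ((b - x') * (2 / D) - s)) * (D / 2) := by
      field_simp
      ring
    rw [e, abs_mul, abs_of_pos (half_pos hD)]
    nlinarith
  refine ⟨-(s * (D / 2)), hausdorffDist_le_of_correspondence hC' (by positivity)
    fun p q hpq => ?_⟩
  obtain ⟨⟨_, _, ⟨⟨a, b⟩, hab, h1⟩, h2⟩, ⟨_, _, ⟨⟨c, d⟩, hcd, h3⟩, h4⟩⟩ :=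
    hs _ _ ⟨(p, q), hpq, rfl⟩
  simp only [Prod.mk.injEq] at h1 h3
  obtain ⟨rfl, rfl⟩ := h1
  obtain ⟨rfl, rfl⟩ := h3
  exact ⟨⟨b, (hC'.1 hab).2, scale _ _ h2⟩, ⟨c, (hC'.1 hcd).1, scale _ _ h4⟩⟩
end

section
/- For every ε with 0 < ε < 1/4 of the form ε = 1/(4(2k+1)) with k ∈ ℕ, and every δ > 0, there exist finite subsets X, Y of ℝ such that d_GH(X,Y) = δ and d_{H,iso}(X,Y) = (5/4 − ε)·δ. In particular, the constant 5/4 in the inequality d_{H,iso} ≤ (5/4)·d_GH for compact subsets of ℝ cannot be improved. -/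
open Metric Set TopologicalSpace

section HausdorffDist

variable {E : Type*} [PseudoMetricSpace E] {s t : Set E}

theorem le_hausdorffDist_of_forall_le_dist {x : E} {r : ℝ} (hx : x ∈ s)
    (fin : hausdorffEDist s t ≠ ⊤) (h : ∀ y ∈ t, r ≤ dist x y) : r ≤ hausdorffDist s t := by
  by_contra! hlt
  obtain ⟨y, hy, hxy⟩ := exists_dist_lt_of_hausdorffDist_lt hx hlt fin
  exact (h y hy).not_gt hxy

theorem le_hausdorffDist_of_forall_le_dist' {y : E} {r : ℝ} (hy : y ∈ t)
    (fin : hausdorffEDist s t ≠ ⊤) (h : ∀ x ∈ s, r ≤ dist x y) : r ≤ hausdorffDist s t := by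
  by_contra! hlt
  obtain ⟨x, hx, hxy⟩ := exists_dist_lt_of_hausdorffDist_lt' hy hlt fin
  exact (h x hx).not_gt hxy

theorem hausdorffDist_image_le_mul {F : Type*} [PseudoMetricSpace F] {f : E → F} {a : ℝ}
    (ha : 0 < a) (hf : ∀ x y, dist (f x) (f y) ≤ a * dist x y) (fin : hausdorffEDist s t ≠ ⊤) :
    hausdorffDist (f '' s) (f '' t) ≤ a * hausdorffDist s t := by
  rw [← div_le_iff₀' ha]
  refine le_of_forall_gt fun r hr => ?_
  obtain ⟨q, hq, hqr⟩ := exists_between hr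
  have hq0 : 0 ≤ q := hausdorffDist_nonneg.trans hq.le
  rw [div_lt_iff₀' ha]
  refine lt_of_le_of_lt (hausdorffDist_le_of_mem_dist (r := a * q) (by positivity) ?_ ?_)
    (mul_lt_mul_of_pos_left hqr ha)
  · rintro _ ⟨x, hx, rfl⟩
    obtain ⟨y, hy, hxy⟩ := exists_dist_lt_of_hausdorffDist_lt hx hq fin
    exact ⟨f y, mem_image_of_mem f hy, (hf x y).trans (by gcongr)⟩
  · rintro _ ⟨y, hy, rfl⟩
    obtain ⟨x, hx, hxy⟩ := exists_dist_lt_of_hausdorffDist_lt' hy hq fin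
    refine ⟨f x, mem_image_of_mem f hx, (hf y x).trans ?_⟩
    rw [dist_comm]
    gcongr

end HausdorffDist

section GromovHausdorff

open GromovHausdorff

theorem ghDistSet_eq_dist {E : Type*} [MetricSpace E] (P Q : NonemptyCompacts E) :
    ghDistSet (P : Set E) Q P.isCompact P.nonempty Q.isCompact Q.nonempty =
      dist P.toGHSpace Q.toGHSpace :=
  rfl

theorem dist_le_add_two_mul_ghDist {E : Type*} [MetricSpace E] (P Q : NonemptyCompacts E) {C : ℝ}
    (hC : ∀ x ∈ P, ∀ x' ∈ P, dist x x' ≤ C) {y y' : E} (hy : y ∈ Q) (hy' : y' ∈ Q) :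
    dist y y' ≤ C + 2 * dist P.toGHSpace Q.toGHSpace := by
  obtain ⟨Φ, Ψ, hΦ, hΨ, h⟩ := ghDist_eq_hausdorffDist P Q
  change dist P.toGHSpace Q.toGHSpace = _ at h
  have fin : hausdorffEDist (range Φ) (range Ψ) ≠ ⊤ :=
    hausdorffEDist_ne_top_of_nonempty_of_bounded (range_nonempty _) (range_nonempty _)
      (isCompact_range hΦ.continuous).isBounded (isCompact_range hΨ.continuous).isBounded
  refine le_of_forall_pos_le_add fun η hη => ?_
  have hlt : hausdorffDist (range Φ) (range Ψ) < dist P.toGHSpace Q.toGHSpace + η / 2 := by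
    rw [← h]; linarith
  obtain ⟨_, ⟨x, rfl⟩, hx⟩ :=
    exists_dist_lt_of_hausdorffDist_lt' (mem_range_self (⟨y, hy⟩ : Q)) hlt fin
  obtain ⟨_, ⟨x', rfl⟩, hx'⟩ :=
    exists_dist_lt_of_hausdorffDist_lt' (mem_range_self (⟨y', hy'⟩ : Q)) hlt fin
  have h1 := dist_triangle4_left (Φ x) (Φ x') (Ψ ⟨y, hy⟩) (Ψ ⟨y', hy'⟩)
  rw [hΨ.dist_eq, hΦ.dist_eq, Subtype.dist_eq, Subtype.dist_eq] at h1
  dsimp only at h1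
  have h2 := hC x x.2 x' x'.2
  linarith

theorem ghDist_le_half_of_surjOn {E : Type*} [MetricSpace E] (P Q : NonemptyCompacts E)
    {f : E → E} {D : ℝ} (hf : MapsTo f P Q) (hsurj : SurjOn f P Q)
    (hD : ∀ x ∈ P, ∀ x' ∈ P, |dist x x' - dist (f x) (f x')| ≤ D) :
    dist P.toGHSpace Q.toGHSpace ≤ D / 2 := by
  have := ghDist_le_of_approx_subsets (X := P) (Y := Q) (s := univ) (ε₁ := 0) (ε₂ := D) (ε₃ := 0)
    (fun x => ⟨f x, hf x.1.2⟩) (fun x => ⟨x, mem_univ _, (dist_self x).le⟩)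
    (fun ⟨y, hy⟩ => by
      obtain ⟨x, hx, rfl⟩ := hsurj hy
      exact ⟨⟨⟨x, hx⟩, mem_univ _⟩, (dist_self _).le⟩)
    (fun x x' => hD x x.1.2 x' x'.1.2)
  rw [zero_add, add_zero] at this
  exact this

end GromovHausdorff

/-- The homothety `x ↦ a * x` acting on nonempty compact sets of reals. -/
noncomputable def dilate (a : ℝ) (P : NonemptyCompacts ℝ) : NonemptyCompacts ℝ :=
  P.map (fun x => a * x) (continuous_const_mul a)

theorem coe_dilate (a : ℝ) (P : NonemptyCompacts ℝ) :
    (dilate a P : Set ℝ) = (fun x => a * x) '' P :=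
  rfl

theorem dilate_dilate (a b : ℝ) (P : NonemptyCompacts ℝ) :
    dilate a (dilate b P) = dilate (a * b) P := by
  apply SetLike.coe_injective
  simp only [coe_dilate, image_image, mul_assoc]

theorem dilate_one (P : NonemptyCompacts ℝ) : dilate 1 P = P := by
  apply SetLike.coe_injective
  simp [coe_dilate]

theorem continuous_dilate (P : NonemptyCompacts ℝ) : Continuous fun a => dilate a P := by
  obtain ⟨C, hC0, hC⟩ := P.isCompact.isBounded.exists_pos_norm_le
  refine (LipschitzWith.of_dist_le_mul (K := C.toNNReal) fun a b => ?_).continuous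
  rw [NonemptyCompacts.dist_eq, Real.coe_toNNReal _ hC0.le]
  have key : ∀ x ∈ P, ∀ a b : ℝ, dist (a * x) (b * x) ≤ C * dist a b := fun x hx a b => by
    rw [Real.dist_eq, ← sub_mul, abs_mul, mul_comm, ← Real.dist_eq]
    exact mul_le_mul_of_nonneg_right (hC x hx) dist_nonneg
  refine hausdorffDist_le_of_mem_dist (by positivity) ?_ ?_
  · rintro _ ⟨x, hx, rfl⟩
    exact ⟨b * x, ⟨x, hx, rfl⟩, key x hx a b⟩
  · rintro _ ⟨x, hx, rfl⟩
    exact ⟨a * x, ⟨x, hx, rfl⟩, by rw [dist_comm a]; exact key x hx b a⟩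

theorem ghDist_dilate_le {a : ℝ} (ha : 0 < a) (P Q : NonemptyCompacts ℝ) :
    dist (dilate a P).toGHSpace (dilate a Q).toGHSpace ≤
      a * dist P.toGHSpace Q.toGHSpace := by
  obtain ⟨Φ, Ψ, hΦ, hΨ, h⟩ := GromovHausdorff.ghDist_eq_hausdorffDist P Q
  change dist P.toGHSpace Q.toGHSpace = _ at h
  have fin : hausdorffEDist (range Φ) (range Ψ) ≠ ⊤ :=
    hausdorffEDist_ne_top_of_nonempty_of_bounded (range_nonempty _) (range_nonempty _)
      (isCompact_range hΦ.continuous).isBounded (isCompact_range hΨ.continuous).isBounded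
  have extend : ∀ (R : NonemptyCompacts ℝ) (Θ : R → lp (fun _ : ℕ => ℝ) ⊤), Isometry Θ →
      ∃ Θ' : dilate a R → lp (fun _ : ℕ => ℝ) ⊤, Isometry Θ' ∧ range Θ' = (fun v => a • v) '' range Θ := by
    intro R Θ hΘ
    have hmem : ∀ x : dilate a R, a⁻¹ * (x : ℝ) ∈ R := by
      rintro ⟨_, x, hx, rfl⟩
      simpa [ha.ne'] using hx
    refine ⟨fun x => a • Θ ⟨a⁻¹ * x, hmem x⟩, Isometry.of_dist_eq fun x y => ?_, ?_⟩
    · rw [dist_smul₀, hΘ.dist_eq, Subtype.dist_eq, Subtype.dist_eq, Real.norm_of_nonneg ha.le,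
        Real.dist_eq, Real.dist_eq, ← mul_sub, abs_mul, abs_of_pos (inv_pos.2 ha),
        mul_inv_cancel_left₀ ha.ne']
    · ext v
      constructor
      · rintro ⟨x, rfl⟩
        exact ⟨_, mem_range_self _, rfl⟩
      · rintro ⟨_, ⟨x, rfl⟩, rfl⟩
        exact ⟨⟨a * x, x, x.2, rfl⟩, by simp [ha.ne']⟩
  obtain ⟨Φ', hΦ', hrΦ⟩ := extend P Φ hΦ
  obtain ⟨Ψ', hΨ', hrΨ⟩ := extend Q Ψ hΨ
  refine (GromovHausdorff.ghDist_le_hausdorffDist hΦ' hΨ').trans ?_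
  rw [h, hrΦ, hrΨ]
  refine hausdorffDist_image_le_mul ha (fun v w => ?_) fin
  rw [dist_smul₀, Real.norm_of_nonneg ha.le]

theorem eq_mul_of_forall_dilate_le {F : NonemptyCompacts ℝ → NonemptyCompacts ℝ → ℝ}
    (hF : ∀ {a : ℝ}, 0 < a → ∀ P Q, F (dilate a P) (dilate a Q) ≤ a * F P Q)
    {a : ℝ} (ha : 0 < a) (P Q : NonemptyCompacts ℝ) :
    F (dilate a P) (dilate a Q) = a * F P Q := by
  refine le_antisymm (hF ha P Q) ?_
  have := hF (inv_pos.2 ha) (dilate a P) (dilate a Q)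
  rwa [dilate_dilate, dilate_dilate, inv_mul_cancel₀ ha.ne', dilate_one, dilate_one,
    le_inv_mul_iff₀ ha] at this

section Isometric

theorem hausdorffEDist_affine_ne_top (P Q : NonemptyCompacts ℝ) (ε c : ℝ) :
    hausdorffEDist (P : Set ℝ) ((fun t => ε * t + c) '' Q) ≠ ⊤ :=
  hausdorffEDist_ne_top_of_nonempty_of_bounded P.nonempty (Q.nonempty.image _)
    P.isCompact.isBounded (Q.isCompact.image (by fun_prop)).isBounded

theorem dHiso_le {ε : ℝ} (X Y : Set ℝ) (hε : ε = 1 ∨ ε = -1) (c : ℝ) :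
    dHiso X Y ≤ hausdorffDist X ((fun t => ε * t + c) '' Y) :=
  csInf_le ⟨0, by rintro _ ⟨_, _, _, rfl⟩; exact hausdorffDist_nonneg⟩ ⟨ε, c, hε, rfl⟩

theorem le_dHiso {X Y : Set ℝ} {r : ℝ}
    (h : ∀ ε c : ℝ, ε = 1 ∨ ε = -1 → r ≤ hausdorffDist X ((fun t => ε * t + c) '' Y)) :
    r ≤ dHiso X Y := by
  refine le_csInf ⟨_, 1, 0, Or.inl rfl, rfl⟩ ?_
  rintro _ ⟨ε, c, hε, rfl⟩
  exact h ε c hε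

theorem continuous_dHiso_left (Q : NonemptyCompacts ℝ) :
    Continuous fun P : NonemptyCompacts ℝ => dHiso P Q := by
  refine (LipschitzWith.of_le_add fun P P' => ?_).continuous
  rw [← sub_le_iff_le_add]
  refine le_dHiso fun ε c hε => ?_
  rw [sub_le_iff_le_add', NonemptyCompacts.dist_eq]
  exact (dHiso_le _ _ hε c).trans (hausdorffDist_triangle
    (hausdorffEDist_ne_top_of_nonempty_of_bounded P.nonempty P'.nonempty
      P.isCompact.isBounded P'.isCompact.isBounded))

theorem dHiso_dilate_le {a : ℝ} (ha : 0 < a) (P Q : NonemptyCompacts ℝ) :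
    dHiso (dilate a P) (dilate a Q) ≤ a * dHiso P Q := by
  rw [← div_le_iff₀' ha]
  refine le_dHiso fun ε c hε => ?_
  rw [div_le_iff₀' ha]
  refine (dHiso_le _ _ hε (a * c)).trans ?_
  have himage : (fun t => ε * t + a * c) '' (dilate a Q : Set ℝ) =
      (fun x => a * x) '' ((fun t => ε * t + c) '' Q) := by
    simp only [coe_dilate, image_image]
    exact image_congr fun x _ => by ring
  rw [himage]
  refine hausdorffDist_image_le_mul ha (fun x y => ?_) (hausdorffEDist_affine_ne_top P Q ε c)
  rw [Real.dist_eq, ← mul_sub, abs_mul, abs_of_pos ha, Real.dist_eq]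

end Isometric

/-- If the ratio `dHiso / ghDist` is at least `ρ ≥ 1` at `(P, Q)` and `P` has smaller diameter, then
shrinking `P` to a point decreases the ratio to at most `1`, so that it takes the value `ρ`. -/
theorem exists_dilate_dHiso_eq {P Q : NonemptyCompacts ℝ} {C m M ρ : ℝ}
    (hP : ∀ x ∈ P, ∀ x' ∈ P, dist x x' ≤ C) (hm : m ∈ Q) (hM : M ∈ Q)
    (hQ : ∀ y ∈ Q, y ∈ Icc m M) (hlt : C < M - m) (hρ : 1 ≤ ρ)
    (h : ρ * dist P.toGHSpace Q.toGHSpace ≤ dHiso P Q) :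
    ∃ a : ℝ, 0 < dist (dilate a P).toGHSpace Q.toGHSpace ∧
      dHiso (dilate a P) Q = ρ * dist (dilate a P).toGHSpace Q.toGHSpace := by
  have hmM : m ≤ M := (hQ m hm).2
  have hdiam : ∀ a ∈ Icc (0 : ℝ) 1,
      M - m ≤ a * C + 2 * dist (dilate a P).toGHSpace Q.toGHSpace := by
    intro a ha
    rw [← abs_of_nonneg (sub_nonneg.2 hmM), ← Real.dist_eq]
    refine dist_le_add_two_mul_ghDist _ _ ?_ hM hm
    rintro _ ⟨x, hx, rfl⟩ _ ⟨x', hx', rfl⟩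
    rw [Real.dist_eq, ← mul_sub, abs_mul, abs_of_nonneg ha.1, ← Real.dist_eq]
    exact mul_le_mul_of_nonneg_left (hP x hx x' hx') ha.1
  have hC : 0 ≤ C := by
    obtain ⟨x, hx⟩ := P.nonempty
    simpa using hP x hx x hx
  have hcont : Continuous fun a : ℝ =>
      dHiso (dilate a P) Q - ρ * dist (dilate a P).toGHSpace Q.toGHSpace :=
    ((continuous_dHiso_left Q).comp (continuous_dilate P)).sub
      ((((GromovHausdorff.toGHSpace_continuous).comp (continuous_dilate P)).dist
        continuous_const).const_mul ρ)
  have h0 : dHiso (dilate 0 P) Q ≤ (M - m) / 2 := by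
    refine (dHiso_le _ _ (Or.inl rfl) (-((m + M) / 2))).trans
      (hausdorffDist_le_of_mem_dist (by linarith) ?_ ?_)
    · rintro _ ⟨x, hx, rfl⟩
      refine ⟨_, ⟨m, hm, rfl⟩, ?_⟩
      rw [Real.dist_eq, abs_le]
      constructor <;> linarith
    · rintro _ ⟨y, hy, rfl⟩
      obtain ⟨x, hx⟩ := P.nonempty
      have := hQ y hy
      refine ⟨_, ⟨x, hx, rfl⟩, ?_⟩
      rw [Real.dist_eq, abs_le]
      constructor <;> linarith [this.1, this.2]
  obtain ⟨a, ha, hroot⟩ := intermediate_value_Icc zero_le_one hcont.continuousOn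
    (show (0 : ℝ) ∈ Icc _ _ from
      ⟨by nlinarith [hdiam 0 ⟨le_rfl, zero_le_one⟩], by rw [dilate_one]; linarith⟩)
  exact ⟨a, by nlinarith [hdiam a ha, ha.1, ha.2], by linarith [hroot]⟩

section Example

/-- The points of the first set: an outlier near the origin, a decreasing progression on its left,
and a far point. -/
def progressionLeft (k : ℕ) : Set ℝ :=
  {-2 * (k : ℝ) - 2, 20 * (k : ℝ) + 20} ∪ (fun i : ℕ => -4 * (k : ℝ) - 4 - 2 * i) '' Iic k

/-- The points of the second set: an outlier on the left, an increasing progression starting at the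
origin, and a far point. -/
def progressionRight (k : ℕ) : Set ℝ :=
  {-10 * (k : ℝ) - 6, 20 * (k : ℝ) + 20} ∪ (fun i : ℕ => 2 * (i : ℝ)) '' Iic k

theorem finite_progressionLeft (k : ℕ) : (progressionLeft k).Finite :=
  (toFinite _).union ((finite_Iic k).image _)

theorem finite_progressionRight (k : ℕ) : (progressionRight k).Finite :=
  (toFinite _).union ((finite_Iic k).image _)

theorem forall_mem_progressionLeft {k : ℕ} {p : ℝ → Prop} :
    (∀ x ∈ progressionLeft k, p x) ↔ p (-2 * k - 2) ∧ p (20 * k + 20) ∧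
      ∀ i : ℕ, i ≤ k → p (-4 * k - 4 - 2 * i) := by
  simp [progressionLeft, or_imp, forall_and, and_assoc]

theorem forall_mem_progressionRight {k : ℕ} {p : ℝ → Prop} :
    (∀ y ∈ progressionRight k, p y) ↔ p (-10 * k - 6) ∧ p (20 * k + 20) ∧
      ∀ i : ℕ, i ≤ k → p (2 * i) := by
  simp [progressionRight, or_imp, forall_and, and_assoc]

/-- The map sending outlier to outlier, fixing the far point, and reflecting the progression. -/
noncomputable def reflectProgression (k : ℕ) (x : ℝ) : ℝ :=
  if x = 20 * k + 20 then x else if x = -2 * k - 2 then -10 * k - 6 else -4 * k - 4 - x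

theorem reflectProgression_outlier (k : ℕ) :
    reflectProgression k (-2 * k - 2) = -10 * k - 6 := by
  have : (-2 * k - 2 : ℝ) ≠ 20 * k + 20 := by
    have : (0 : ℝ) ≤ k := by positivity
    intro h
    linarith
  rw [reflectProgression, if_neg this, if_pos rfl]

theorem reflectProgression_far (k : ℕ) :
    reflectProgression k (20 * k + 20) = 20 * k + 20 :=
  if_pos rfl

theorem reflectProgression_progression (k i : ℕ) :
    reflectProgression k (-4 * k - 4 - 2 * i) = 2 * i := by
  have hk : (0 : ℝ) ≤ k := by positivity
  have hi : (0 : ℝ) ≤ i := by positivity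
  rw [reflectProgression, if_neg (fun h => by linarith), if_neg (fun h => by linarith)]
  ring

theorem abs_dist_sub_dist_reflectProgression_le (k : ℕ) :
    ∀ x ∈ progressionLeft k, ∀ x' ∈ progressionLeft k,
      |dist x x' - dist (reflectProgression k x) (reflectProgression k x')| ≤ 8 * k + 4 := by
  have hk : (0 : ℝ) ≤ k := by positivity
  have habs : ∀ {u v a b D : ℝ}, 0 ≤ u → 0 ≤ v → (a = u ∨ a = -u) → (b = v ∨ b = -v) →
      u - v ≤ D → v - u ≤ D → |(|a| - |b|)| ≤ D := by
    rintro u v a b D hu hv (rfl | rfl) (rfl | rfl) h h' <;>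
      simp only [abs_neg, abs_of_nonneg hu, abs_of_nonneg hv, abs_le] <;>
      constructor <;> linarith
  simp only [forall_mem_progressionLeft, reflectProgression_outlier, reflectProgression_far,
    reflectProgression_progression, Real.dist_eq]
  have hcast : ∀ i : ℕ, i ≤ k → (0 : ℝ) ≤ i ∧ (i : ℝ) ≤ k := fun i hi =>
    ⟨by positivity, by exact_mod_cast hi⟩
  refine ⟨⟨?_, ?_, fun j hj => ?_⟩, ⟨?_, ?_, fun j hj => ?_⟩,
    fun i hi => ⟨?_, ?_, fun j hj => ?_⟩⟩
  · simp; linarith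
  · refine habs (u := 22 * k + 22) (v := 30 * k + 26) ?_ ?_ (.inr ?_) (.inr ?_) ?_ ?_ <;> linarith
  · have := hcast j hj
    refine habs (u := 2 * k + 2 + 2 * j) (v := 10 * k + 6 + 2 * j) ?_ ?_ (.inl ?_) (.inr ?_) ?_ ?_
      <;> linarith
  · refine habs (u := 22 * k + 22) (v := 30 * k + 26) ?_ ?_ (.inl ?_) (.inl ?_) ?_ ?_ <;> linarith
  · simp; linarith
  · have := hcast j hj
    refine habs (u := 24 * k + 24 + 2 * j) (v := 20 * k + 20 - 2 * j) ?_ ?_ (.inl ?_) (.inl ?_) ?_ ?_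
      <;> linarith
  · have := hcast i hi
    refine habs (u := 2 * k + 2 + 2 * i) (v := 10 * k + 6 + 2 * i) ?_ ?_ (.inr ?_) (.inl ?_) ?_ ?_
      <;> linarith
  · have := hcast i hi
    refine habs (u := 24 * k + 24 + 2 * i) (v := 20 * k + 20 - 2 * i) ?_ ?_ (.inr ?_) (.inr ?_) ?_ ?_
      <;> linarith
  · rw [show (-4 * k - 4 - 2 * i - (-4 * k - 4 - 2 * j) : ℝ) = -(2 * i - 2 * j) by ring, abs_neg]
    simp; linarith

theorem mapsTo_reflectProgression (k : ℕ) :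
    MapsTo (reflectProgression k) (progressionLeft k) (progressionRight k) := by
  refine forall_mem_progressionLeft.2 ⟨?_, ?_, fun i hi => ?_⟩
  · rw [reflectProgression_outlier]; simp [progressionRight]
  · rw [reflectProgression_far]; simp [progressionRight]
  · rw [reflectProgression_progression]; exact .inr ⟨i, hi, rfl⟩

theorem surjOn_reflectProgression (k : ℕ) :
    SurjOn (reflectProgression k) (progressionLeft k) (progressionRight k) := by
  refine forall_mem_progressionRight.2 ⟨?_, ?_, fun i hi => ?_⟩
  · exact ⟨_, by simp [progressionLeft], reflectProgression_outlier k⟩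
  · exact ⟨_, by simp [progressionLeft], reflectProgression_far k⟩
  · exact ⟨_, .inr ⟨i, hi, rfl⟩, reflectProgression_progression k i⟩

theorem le_dHiso_progression (k : ℕ) :
    5 * k + 2 ≤ dHiso (progressionLeft k) (progressionRight k) := by
  have hk : (0 : ℝ) ≤ k := by positivity
  have hcast : ∀ i : ℕ, i ≤ k → (0 : ℝ) ≤ i ∧ (i : ℝ) ≤ k := fun i hi =>
    ⟨by positivity, by exact_mod_cast hi⟩
  have hXn : (progressionLeft k).Nonempty := ⟨20 * k + 20, by simp [progressionLeft]⟩
  have hYn : (progressionRight k).Nonempty := ⟨20 * k + 20, by simp [progressionRight]⟩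
  refine le_dHiso fun ε c hε => ?_
  have fin : hausdorffEDist (progressionLeft k) ((fun t => ε * t + c) '' progressionRight k) ≠ ⊤ :=
    hausdorffEDist_ne_top_of_nonempty_of_bounded hXn (hYn.image _)
      (finite_progressionLeft k).isBounded ((finite_progressionRight k).image _).isBounded
  have of_left : ∀ x ∈ progressionLeft k,
      (∀ y ∈ progressionRight k, 5 * k + 2 ≤ |x - (ε * y + c)|) →
      5 * k + 2 ≤ hausdorffDist (progressionLeft k) ((fun t => ε * t + c) '' progressionRight k) :=
    fun x hx h => le_hausdorffDist_of_forall_le_dist hx fin (forall_mem_image.2 h)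
  have of_right : ∀ y ∈ progressionRight k,
      (∀ x ∈ progressionLeft k, 5 * k + 2 ≤ |x - (ε * y + c)|) →
      5 * k + 2 ≤ hausdorffDist (progressionLeft k) ((fun t => ε * t + c) '' progressionRight k) :=
    fun y hy h => le_hausdorffDist_of_forall_le_dist' (mem_image_of_mem _ hy) fin h
  simp only [forall_mem_progressionLeft, forall_mem_progressionRight, le_abs] at of_left of_right
  obtain ⟨-, left_far, left_progression⟩ := of_left
  obtain ⟨right_outlier, right_far, right_progression⟩ := of_right
  rcases hε with rfl | rfl
  · rcases le_or_gt c (-k) with h1 | h1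
    · refine right_outlier ⟨.inl ?_, .inl ?_, fun i hi => .inl ?_⟩
      · linarith
      · linarith
      · linarith [hcast i hi]
    rcases le_or_gt c k with h2 | h2
    · obtain ⟨i, hi, hci, hci'⟩ : ∃ i : ℕ, i ≤ k ∧ (k : ℝ) - 2 - 2 * i ≤ c ∧ c ≤ k - 2 * i := by
        refine ⟨⌊(k - c) / 2⌋₊, ?_, ?_, ?_⟩
        · refine Nat.floor_le_of_le ?_
          linarith
        · linarith [Nat.lt_floor_add_one ((k - c) / 2)]
        · linarith [Nat.floor_le (show 0 ≤ (k - c) / 2 by linarith)]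
      have := hcast i hi
      refine left_progression i hi ⟨.inl ?_, .inr ?_, fun j hj => .inr ?_⟩
      · linarith
      · linarith
      · linarith [hcast j hj]
    rcases le_or_gt c (13 * k + 18) with h3 | h3
    · refine right_progression k le_rfl ⟨.inr ?_, .inl ?_, fun i hi => .inr ?_⟩
      · linarith
      · linarith
      · linarith [hcast i hi]
    · refine right_far ⟨.inr ?_, .inr ?_, fun i hi => .inr ?_⟩
      · linarith
      · linarith
      · linarith [hcast i hi]
  · rcases le_or_gt (15 * (k : ℝ) + 16) c with h1 | h1
    · refine right_outlier ⟨.inr ?_, .inr ?_, fun i hi => .inr ?_⟩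
      · linarith
      · linarith
      · linarith [hcast i hi]
    rcases le_or_gt c (9 * k + 14) with h2 | h2
    · refine right_far ⟨.inl ?_, .inl ?_, fun i hi => .inl ?_⟩
      · linarith
      · linarith
      · linarith [hcast i hi]
    · refine right_progression 0 (Nat.zero_le k) ⟨.inr ?_, .inl ?_, fun i hi => .inr ?_⟩
      · push_cast; linarith
      · push_cast; linarith
      · push_cast; linarith [hcast i hi]

end Example

theorem tightness_of_five_fourth (k : ℕ) (δ : ℝ) (hδ : 0 < δ) :
    ∃ (X Y : Set ℝ) (hXf : X.Finite) (hYf : Y.Finite) (hXn : X.Nonempty) (hYn : Y.Nonempty),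
      ghDistSet X Y hXf.isCompact hXn hYf.isCompact hYn = δ ∧
      dHiso X Y = (5 / 4 - 1 / (4 * (2 * (k : ℝ) + 1))) * δ := by
  have hk : (0 : ℝ) ≤ k := by positivity
  have hcast : ∀ i : ℕ, i ≤ k → (0 : ℝ) ≤ i ∧ (i : ℝ) ≤ k := fun i hi =>
    ⟨by positivity, by exact_mod_cast hi⟩
  set ρ : ℝ := 5 / 4 - 1 / (4 * (2 * (k : ℝ) + 1)) with hρ
  have hρk : ρ * (4 * k + 2) = 5 * k + 2 := by
    rw [hρ]
    field_simp
    ring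
  have hρ1 : 1 ≤ ρ := by nlinarith
  let P : NonemptyCompacts ℝ :=
    ⟨⟨progressionLeft k, (finite_progressionLeft k).isCompact⟩, 20 * k + 20,
      by simp [progressionLeft]⟩
  let Q : NonemptyCompacts ℝ :=
    ⟨⟨progressionRight k, (finite_progressionRight k).isCompact⟩, 20 * k + 20,
      by simp [progressionRight]⟩
  have hgh : dist P.toGHSpace Q.toGHSpace ≤ (8 * k + 4) / 2 :=
    ghDist_le_half_of_surjOn P Q (mapsTo_reflectProgression k) (surjOn_reflectProgression k)
      (abs_dist_sub_dist_reflectProgression_le k)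
  have hPmem : ∀ x ∈ P, -6 * (k : ℝ) - 4 ≤ x ∧ x ≤ 20 * k + 20 := by
    refine forall_mem_progressionLeft.2 ⟨?_, ?_, fun i hi => ?_⟩
    · constructor <;> linarith
    · constructor <;> linarith
    · constructor <;> linarith [hcast i hi]
  have hQmem : ∀ y ∈ Q, y ∈ Icc (-10 * (k : ℝ) - 6) (20 * k + 20) := by
    refine forall_mem_progressionRight.2 ⟨?_, ?_, fun i hi => ?_⟩
    · constructor <;> linarith
    · constructor <;> linarith
    · constructor <;> linarith [hcast i hi]
  have hPdist : ∀ x ∈ P, ∀ x' ∈ P, dist x x' ≤ 26 * k + 24 := by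
    intro x hx x' hx'
    have := hPmem x hx
    have := hPmem x' hx'
    rw [Real.dist_eq, abs_le]
    constructor <;> linarith
  have hratio : ρ * dist P.toGHSpace Q.toGHSpace ≤ dHiso P Q :=
    calc ρ * dist P.toGHSpace Q.toGHSpace ≤ ρ * ((8 * k + 4) / 2) := by gcongr
      _ = 5 * k + 2 := by rw [← hρk]; ring
      _ ≤ dHiso P Q := le_dHiso_progression k
  obtain ⟨a, hpos, heq⟩ := exists_dilate_dHiso_eq (m := -10 * k - 6) (M := 20 * k + 20) hPdist
    (by change _ ∈ progressionRight k; simp [progressionRight])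
    (by change _ ∈ progressionRight k; simp [progressionRight]) hQmem (by linarith) hρ1 hratio
  set d := dist (dilate a P).toGHSpace Q.toGHSpace
  have hb : 0 < δ / d := by positivity
  refine ⟨dilate (δ / d) (dilate a P), dilate (δ / d) Q,
    ((finite_progressionLeft k).image _).image _, (finite_progressionRight k).image _,
    NonemptyCompacts.nonempty _, NonemptyCompacts.nonempty _, ?_, ?_⟩
  · rw [ghDistSet_eq_dist, eq_mul_of_forall_dilate_le (F := fun P Q => dist P.toGHSpace Q.toGHSpace)
      ghDist_dilate_le hb]
    exact div_mul_cancel₀ δ hpos.ne'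
  · rw [eq_mul_of_forall_dilate_le (F := fun P Q => dHiso P Q) dHiso_dilate_le hb, heq,
      mul_left_comm, div_mul_cancel₀ δ hpos.ne']
end
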